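/- arXiv:math/9908071 — 13 statements merged into one kernel-verified Lean document; each statement's English description precedes it below -/
import Mathlib

section
/- Let τ be an infinite cardinal, let A be a τ-complete directed partially ordered set, and let {A_t : t ∈ T} be a family of subsets of A each of which is cofinal and τ-closed in A. If |T| ≤ τ, then the intersection ⋂_{t∈T} A_t is cofinal in A (in particular, non-empty) and τ-closed in A. -/
universe u v

open Cardinal Set

noncomputable section

/-- A subset `B` of a preordered set is *cofinal* if every element of the
ambient set lies below some element of `B`. -/
def CofinalIn {A : Type u} [Preorder A] (B : Set A) : Prop :=
  ∀ a : A, ∃ b ∈ B, a ≤ b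

/-- A subset `B` of a preordered set is *τ-closed* if for every nonempty chain
`C ⊆ B` of cardinality at most `τ` whose least upper bound exists in the
ambient set, that least upper bound belongs to `B`. -/
def TauClosed {A : Type u} [Preorder A] (τ : Cardinal.{u}) (B : Set A) : Prop :=
  ∀ C : Set A, C ⊆ B → IsChain (· ≤ ·) C → C.Nonempty → #C ≤ τ →
    ∀ s : A, IsLUB C s → s ∈ B

/-- A preordered set is *τ-complete* if every nonempty chain of cardinality at
most `τ` has a least upper bound. -/
def TauComplete (A : Type u) [Preorder A] (τ : Cardinal.{u}) : Prop :=
  ∀ C : Set A, IsChain (· ≤ ·) C → C.Nonempty → #C ≤ τ → ∃ s : A, IsLUB C s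

theorem bdd_aux {A : Type u} [PartialOrder A] [Nonempty A]
    {τ : Cardinal.{u}}
    (hdir : ∀ a b : A, ∃ c, a ≤ c ∧ b ≤ c) (hcomp : TauComplete A τ)
    {T : Type u} (hT : #T ≤ τ) (f : T → A) : ∃ c, ∀ t, f t ≤ c := by
  classical
  obtain ⟨lo, wo⟩ := exists_wellFoundedLT T
  let step : (t : T) → ((s : T) → s < t → A) → A := fun t g =>
    if h : ∃ c, f t ≤ c ∧ ∀ s (hs : s < t), g s hs ≤ c then h.choose
    else Classical.arbitrary A
  let g : T → A := wo.wf.fix step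
  have hg : ∀ t, g t = step t (fun s _ => g s) := fun t => wo.wf.fix_eq step t
  have key : ∀ t, f t ≤ g t ∧ ∀ s, s < t → g s ≤ g t := by
    intro t
    induction t using wo.wf.induction with
    | _ t ih =>
      have hex : ∃ c, f t ≤ c ∧ ∀ s (_ : s < t), g s ≤ c := by
        by_cases hne : (g '' {s | s < t}).Nonempty
        · have hch : IsChain (· ≤ ·) (g '' {s | s < t}) := by
            rintro _ ⟨x, hx, rfl⟩ _ ⟨y, hy, rfl⟩ _
            rcases lt_trichotomy x y with h | h | h
            · exact Or.inl ((ih y hy).2 x h)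
            · exact Or.inl (h ▸ le_rfl)
            · exact Or.inr ((ih x hx).2 y h)
          obtain ⟨c, hc⟩ := hcomp _ hch hne
            (mk_image_le.trans ((mk_set_le _).trans hT))
          obtain ⟨d, h1, h2⟩ := hdir (f t) c
          exact ⟨d, h1, fun s hs => (hc.1 ⟨s, hs, rfl⟩).trans h2⟩
        · exact ⟨f t, le_rfl, fun s hs => (hne ⟨_, s, hs, rfl⟩).elim⟩
      have e : g t = hex.choose := by
        rw [hg t]
        exact dif_pos hex
      rw [e]
      exact hex.choose_spec
  rcases isEmpty_or_nonempty T with hE | hE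
  · exact ⟨Classical.arbitrary A, fun t => hE.elim t⟩
  · have hch : IsChain (· ≤ ·) (range g) := by
      rintro _ ⟨x, rfl⟩ _ ⟨y, rfl⟩ _
      rcases lt_trichotomy x y with h | h | h
      · exact Or.inl ((key y).2 x h)
      · exact Or.inl (h ▸ le_rfl)
      · exact Or.inr ((key x).2 y h)
    obtain ⟨c, hc⟩ := hcomp _ hch (range_nonempty g) (mk_range_le.trans hT)
    exact ⟨c, fun t => (key t).1.trans (hc.1 ⟨t, rfl⟩)⟩

theorem nat_aux {A : Type u} {τ : Cardinal.{u}} (hτ : ℵ₀ ≤ τ) (g : ℕ → A) :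
    #(range g) ≤ τ :=
  ((countable_range g).le_aleph0).trans hτ

/-- Let `τ` be an infinite cardinal, `A` a τ-complete directed
partially ordered set, and `(S t)` a family of cofinal τ-closed subsets of `A`
indexed by a set `T` with `|T| ≤ τ`.  Then `⋂ t, S t` is nonempty, cofinal and
τ-closed in `A`. -/
theorem iInter_cofinal_tauClosed {A : Type u} [PartialOrder A] [Nonempty A]
    {τ : Cardinal.{u}} (hτ : ℵ₀ ≤ τ)
    (hdir : ∀ a b : A, ∃ c, a ≤ c ∧ b ≤ c) (hcomp : TauComplete A τ)
    {T : Type u} (hT : #T ≤ τ) (S : T → Set A)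
    (hcof : ∀ t, CofinalIn (S t)) (hcl : ∀ t, TauClosed τ (S t)) :
    (⋂ t, S t).Nonempty ∧ CofinalIn (⋂ t, S t) ∧ TauClosed τ (⋂ t, S t) := by
  have hcofI : CofinalIn (⋂ t, S t) := by
    have hstep : ∀ a : A, ∃ a', a ≤ a' ∧ ∀ t, ∃ b ∈ S t, a ≤ b ∧ b ≤ a' := by
      intro a
      choose b hb hab using fun t => hcof t a
      obtain ⟨c, hc⟩ := bdd_aux hdir hcomp hT b
      obtain ⟨d, h1, h2⟩ := hdir a c
      exact ⟨d, h1, fun t => ⟨b t, hb t, hab t, (hc t).trans h2⟩⟩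
    choose F hF B hB hB1 hB2 using hstep
    intro a
    let x : ℕ → A := fun n => F^[n] a
    have hx : ∀ n, x (n + 1) = F (x n) := fun n => Function.iterate_succ_apply' F n a
    have hmono : Monotone x := monotone_nat_of_le_succ fun n => by
      rw [hx]; exact hF _
    obtain ⟨s, hs⟩ := hcomp (range x) hmono.isChain_range (range_nonempty x) (nat_aux hτ x)
    refine ⟨s, mem_iInter.2 fun t => ?_, hs.1 ⟨0, rfl⟩⟩
    have hm : Monotone fun n => B (x n) t := monotone_nat_of_le_succ fun n =>
      ((hB2 (x n) t).trans (hx n).ge).trans (hB1 (x (n + 1)) t)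
    refine hcl t (range fun n => B (x n) t) ?_ hm.isChain_range (range_nonempty _)
      (nat_aux hτ _) s ⟨?_, ?_⟩
    · rintro _ ⟨n, rfl⟩
      exact hB _ t
    · rintro _ ⟨n, rfl⟩
      exact ((hB2 (x n) t).trans (hx n).ge).trans (hs.1 ⟨n + 1, rfl⟩)
    · intro u hu
      apply hs.2
      rintro _ ⟨n, rfl⟩
      exact (hB1 (x n) t).trans (hu ⟨n, rfl⟩)
  refine ⟨?_, hcofI, ?_⟩
  · obtain ⟨b, hb, _⟩ := hcofI (Classical.arbitrary A)
    exact ⟨b, hb⟩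
  · intro C hC hch hne hcard s hs
    exact mem_iInter.2 fun t =>
      hcl t C (fun c hc => mem_iInter.1 (hC hc) t) hch hne hcard s hs
end
end

section
/- Let τ be an infinite cardinal and let A be a τ-complete directed partially ordered set. Then for every subset B ⊆ A with |B| ≤ τ there exists an element γ ∈ A such that γ ≥ β for every β ∈ B. -/
universe u v

open Cardinal Set

noncomputable section

/-- In a τ-complete directed partially ordered set, every
subset of cardinality at most `τ` has an upper bound. -/
theorem exists_upperBound_of_card_le {A : Type u} [PartialOrder A] [Nonempty A]
    {τ : Cardinal.{u}} (hτ : ℵ₀ ≤ τ)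
    (hdir : ∀ a b : A, ∃ c, a ≤ c ∧ b ≤ c) (hcomp : TauComplete A τ)
    (B : Set A) (hB : #B ≤ τ) :
    ∃ γ : A, ∀ β ∈ B, β ≤ γ := by
  classical
  choose j hj1 hj2 using hdir
  let r : B → B → Prop := WellOrderingRel
  have wf : WellFounded r := WellOrderingRel.isWellOrder.wf
  have tri : ∀ x y : B, r x y ∨ x = y ∨ r y x := fun x y =>
    trichotomous_of WellOrderingRel x y
  let F : (b : B) → ((y : B) → r y b → A) → A := fun b ih =>
    if h : ∃ g : A, ∀ y hy, ih y hy ≤ g then j b.1 h.choose else b.1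
  let f : B → A := wf.fix F
  have hf : ∀ b, f b = F b (fun y _ => f y) := fun b => wf.fix_eq F b
  have hle : ∀ b : B, b.1 ≤ f b := by
    intro b
    rw [hf]
    simp only [F]
    split_ifs
    · exact hj1 _ _
    · exact le_rfl
  have key : ∀ b : B, ∀ c, r c b → f c ≤ f b := by
    intro b
    induction b using wf.induction with
    | _ b IH =>
    have hex : ∃ g : A, ∀ y, r y b → f y ≤ g := by
      by_cases hne : ∃ y, r y b
      · obtain ⟨y0, hy0⟩ := hne
        obtain ⟨s, hs⟩ := hcomp (f '' {y | r y b}) (by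
          rintro _ ⟨x, hx, rfl⟩ _ ⟨y, hy, rfl⟩ _
          rcases tri x y with h | h | h
          · exact Or.inl (IH y hy x h)
          · exact Or.inl (h ▸ le_rfl)
          · exact Or.inr (IH x hx y h)) ⟨_, y0, hy0, rfl⟩
          ((mk_image_le).trans ((mk_set_le _).trans hB))
        exact ⟨s, fun y hy => hs.1 ⟨y, hy, rfl⟩⟩
      · exact ⟨b.1, fun y hy => (hne ⟨y, hy⟩).elim⟩
    intro c hc
    rw [hf b]
    simp only [F]
    rw [dif_pos hex]
    exact (hex.choose_spec c hc).trans (hj2 _ _)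
  by_cases hne : B.Nonempty
  · obtain ⟨b0, hb0⟩ := hne
    obtain ⟨s, hs⟩ := hcomp (range f) (by
      rintro _ ⟨x, rfl⟩ _ ⟨y, rfl⟩ _
      rcases tri x y with h | h | h
      · exact Or.inl (key y x h)
      · exact Or.inl (h ▸ le_rfl)
      · exact Or.inr (key x y h)) ⟨_, ⟨b0, hb0⟩, rfl⟩
      (mk_range_le.trans hB)
    exact ⟨s, fun β hβ => (hle ⟨β, hβ⟩).trans (hs.1 ⟨_, rfl⟩)⟩
  · exact ⟨Classical.arbitrary A, fun β hβ => (hne ⟨β, hβ⟩).elim⟩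
end
end

section
/- (Spectral Search.) Let τ be an infinite cardinal, let A be a τ-complete directed partially ordered set, and let L ⊆ A × A be a relation satisfying: (Existence) for each α ∈ A there exists β ∈ A with (α, β) ∈ L; (Majorantness) if (α, β) ∈ L and γ ≥ β then (α, γ) ∈ L; (τ-closeness) if {α_t : t ∈ T} is a chain in A with |T| ≤ τ, β ∈ A and (α_t, β) ∈ L for each t ∈ T, then (α, β) ∈ L where α = sup{α_t : t ∈ T}. Then the set of all L-reflexive elements of A (elements α with (α, α) ∈ L) is cofinal and τ-closed in A. -/
universe u v

open Cardinal Set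

noncomputable section

/-- **Spectral Search.** Let `A` be a τ-complete directed poset
and `L` a relation on `A` satisfying Existence, Majorantness and τ-closeness.
Then the set of `L`-reflexive elements is cofinal and τ-closed in `A`. -/
theorem spectral_search {A : Type u} [PartialOrder A] [Nonempty A]
    {τ : Cardinal.{u}} (hτ : ℵ₀ ≤ τ)
    (hdir : ∀ a b : A, ∃ c, a ≤ c ∧ b ≤ c) (hcomp : TauComplete A τ)
    (L : A → A → Prop)
    (hex : ∀ α : A, ∃ β : A, L α β)
    (hmaj : ∀ α β γ : A, L α β → β ≤ γ → L α γ)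
    (hclose : ∀ C : Set A, IsChain (· ≤ ·) C → C.Nonempty → #C ≤ τ →
      ∀ β : A, (∀ c ∈ C, L c β) → ∀ s : A, IsLUB C s → L s β) :
    CofinalIn {α : A | L α α} ∧ TauClosed τ {α : A | L α α} := by
  constructor
  · intro a
    have hstep : ∀ x : A, ∃ y, x ≤ y ∧ L x y := by
      intro x
      obtain ⟨b, hb⟩ := hex x
      obtain ⟨c, hxc, hbc⟩ := hdir x b
      exact ⟨c, hxc, hmaj x b c hb hbc⟩
    choose f hf hL using hstep
    let g : ℕ → A := fun n => Nat.rec a (fun _ x => f x) n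
    have hmono : Monotone g := monotone_nat_of_le_succ (fun n => hf (g n))
    have hchain : IsChain (· ≤ ·) (Set.range g) := hmono.isChain_range
    have hne : (Set.range g).Nonempty := ⟨g 0, 0, rfl⟩
    have hcard : #(Set.range g) ≤ τ :=
      le_trans ((Set.countable_range g).le_aleph0) hτ
    obtain ⟨s, hs⟩ := hcomp _ hchain hne hcard
    refine ⟨s, ?_, hs.1 ⟨0, rfl⟩⟩
    refine hclose _ hchain hne hcard s ?_ s hs
    rintro _ ⟨n, rfl⟩
    exact hmaj _ (g (n+1)) _ (hL (g n)) (hs.1 ⟨n+1, rfl⟩)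
  · intro C hC hchain hne hcard s hs
    exact hclose C hchain hne hcard s (fun c hc => hmaj c c s (hC hc) (hs.1 hc)) s hs
end
end

section
/- Let τ be an infinite cardinal, X a unital C*-algebra, and (A, (X_α)_{α∈A}) a direct C*_τ-system of subalgebras of X. Then X = ⋃_{α∈A} X_α; that is, the union of the subalgebras X_α is already all of X (not merely dense). -/
universe u v

open Cardinal Set

noncomputable section

/-- A *direct C*_τ-system of subalgebras* of a unital C*-algebra `X`:
a τ-complete directed poset `A` together with a monotone family of closed
unital `*`-subalgebras `F α` of `X` such that each `F α` has density at most
`τ`, for every nonempty chain `C` in `A` of cardinality at most `τ` with least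
upper bound `s` the subalgebra `F s` is the closure of `⋃ β ∈ C, F β`, and the
union of all the `F α` is dense in `X`. -/
def IsDirectCSystem (τ : Cardinal.{u}) {X : Type u} [CStarAlgebra X]
    (A : Type u) [PartialOrder A] (F : A → StarSubalgebra ℂ X) : Prop :=
  (∀ a b : A, ∃ c, a ≤ c ∧ b ≤ c) ∧
  TauComplete A τ ∧
  (∀ α : A, IsClosed (F α : Set X)) ∧
  Monotone F ∧
  (∀ α : A, ∃ D : Set X, D ⊆ (F α : Set X) ∧ #D ≤ τ ∧ (F α : Set X) ⊆ closure D) ∧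
  (∀ C : Set A, IsChain (· ≤ ·) C → C.Nonempty → #C ≤ τ → ∀ s : A, IsLUB C s →
      (F s : Set X) = closure (⋃ β ∈ C, (F β : Set X))) ∧
  closure (⋃ α : A, (F α : Set X)) = (Set.univ : Set X)

/-- If `(A, F)` is a direct C*_τ-system of subalgebras of a
unital C*-algebra `X`, then the union of the subalgebras `F α` is all of `X`
(not merely dense). -/
theorem iUnion_eq_univ_of_isDirectCSystem {X : Type u} [CStarAlgebra X]
    {τ : Cardinal.{u}} (hτ : ℵ₀ ≤ τ)
    {A : Type u} [PartialOrder A] {F : A → StarSubalgebra ℂ X}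
    (hF : IsDirectCSystem τ A F) :
    (⋃ α : A, (F α : Set X)) = (Set.univ : Set X) := by
  obtain ⟨hdir, hcomp, hcl, hmono, -, -, hdense⟩ := hF
  refine Set.eq_univ_of_forall fun x => ?_
  have hx : x ∈ closure (⋃ α : A, (F α : Set X)) := by rw [hdense]; trivial
  obtain ⟨u, hu, hlim⟩ := mem_closure_iff_seq_limit.1 hx
  choose a ha using fun n => Set.mem_iUnion.1 (hu n)
  choose j hj1 hj2 using hdir
  let b : ℕ → A := fun n => Nat.rec (a 0) (fun n c => j c (a (n + 1))) n
  have hb : Monotone b := monotone_nat_of_le_succ fun n => hj1 (b n) (a (n + 1))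
  have hab : ∀ n, a n ≤ b n := by
    intro n
    cases n with
    | zero => exact le_refl _
    | succ n => exact hj2 (b n) (a (n + 1))
  have hchain : IsChain (· ≤ ·) (Set.range b) := hb.isChain_range
  obtain ⟨s, hs⟩ := hcomp (Set.range b) hchain ⟨b 0, 0, rfl⟩
    ((Set.countable_range b).le_aleph0.trans hτ)
  refine Set.mem_iUnion.2 ⟨s, (hcl s).mem_of_tendsto hlim (Filter.Eventually.of_forall fun n => ?_)⟩
  exact hmono ((hab n).trans (hs.1 ⟨n, rfl⟩)) (ha n)
end
end

section
/- Let τ be an infinite cardinal, X a unital C*-algebra, and (A, (X_α)_{α∈A}) a direct C*_τ-system of subalgebras of X. Let Y be a unital C*-algebra with density ≤ τ and let f : Y → X be a unital *-homomorphism. Then there exists an index α ∈ A such that the range of f is contained in X_α. -/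
universe u v

open Cardinal Set

noncomputable section

open Classical in
/-- In a directed τ-complete poset, every family of size at most τ is bounded. -/
theorem aux_bounded {A : Type u} [PartialOrder A] {τ : Cardinal.{u}} [Nonempty A]
    (hd : ∀ a b : A, ∃ c, a ≤ c ∧ b ≤ c) (hc : TauComplete A τ)
    {ι : Type u} (hι : #ι ≤ τ) (x : ι → A) : ∃ c, ∀ i, x i ≤ c := by
  rcases isEmpty_or_nonempty ι with hE | hN
  · exact ⟨Classical.arbitrary A, fun i => (hE.false i).elim⟩
  obtain ⟨r, hr⟩ := exists_wellOrder ι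
  let s : ι → A := (wellFounded_lt (α := ι)).fix (fun i g =>
    if h : ∃ c, (∀ j (hj : j < i), g j hj ≤ c) ∧ x i ≤ c then h.choose
    else Classical.arbitrary A)
  have hs : ∀ i, s i = if h : ∃ c, (∀ j, j < i → s j ≤ c) ∧ x i ≤ c then h.choose
    else Classical.arbitrary A := fun i => WellFounded.fix_eq _ _ i
  have key : ∀ i, (∀ j, j < i → s j ≤ s i) ∧ x i ≤ s i := by
    intro i
    induction i using (wellFounded_lt (α := ι)).induction with
    | _ i ih =>
    have h : ∃ c, (∀ j, j < i → s j ≤ c) ∧ x i ≤ c := by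
      by_cases hne : ∃ j, j < i
      · obtain ⟨t, ht⟩ := hc (s '' Set.Iio i) (by
          rintro _ ⟨j, hj, rfl⟩ _ ⟨k, hk, rfl⟩ _
          rcases lt_trichotomy j k with h | h | h
          · exact Or.inl ((ih k hk).1 j h)
          · subst h; exact Or.inl le_rfl
          · exact Or.inr ((ih j hj).1 k h)) (Set.Nonempty.image s hne)
          (mk_image_le.trans ((mk_set_le _).trans hι))
        obtain ⟨c, h1, h2⟩ := hd t (x i)
        exact ⟨c, fun j hj => (ht.1 ⟨j, hj, rfl⟩).trans h1, h2⟩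
      · exact ⟨x i, fun j hj => (hne ⟨j, hj⟩).elim, le_rfl⟩
    have e : s i = h.choose := by rw [hs i, dif_pos h]
    rw [e]
    exact h.choose_spec
  obtain ⟨t, ht⟩ := hc (Set.range s) (by
    rintro _ ⟨j, rfl⟩ _ ⟨k, rfl⟩ _
    rcases lt_trichotomy j k with h | h | h
    · exact Or.inl ((key k).1 j h)
    · subst h; exact Or.inl le_rfl
    · exact Or.inr ((key j).1 k h)) (Set.range_nonempty s) (mk_range_le.trans hι)
  exact ⟨t, fun i => (key i).2.trans (ht.1 ⟨i, rfl⟩)⟩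

/-- If `(A, F)` is a direct C*_τ-system of subalgebras of a
unital C*-algebra `X` and `f : Y → X` is a unital `*`-homomorphism from a
unital C*-algebra `Y` of density at most `τ`, then the range of `f` is
contained in some `F α`. -/
theorem range_subset_of_isDirectCSystem {X : Type u} [CStarAlgebra X]
    {τ : Cardinal.{u}} (hτ : ℵ₀ ≤ τ)
    {A : Type u} [PartialOrder A] {F : A → StarSubalgebra ℂ X}
    (hF : IsDirectCSystem τ A F)
    (Y : Type u) [CStarAlgebra Y] (hY : ∃ D : Set Y, Dense D ∧ #D ≤ τ)
    (f : Y →⋆ₐ[ℂ] X) :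
    ∃ α : A, Set.range f ⊆ (F α : Set X) := by
  obtain ⟨hd, hc, hcl, hm, -, -, hu⟩ := hF
  obtain ⟨D, hD, hDτ⟩ := hY
  have hx : ∀ (y : X) (n : ℕ), ∃ α : A, ∃ z ∈ F α, dist y z < 1 / ((n : ℝ) + 1) := by
    intro y n
    have hy : y ∈ closure (⋃ α : A, (F α : Set X)) := by rw [hu]; trivial
    obtain ⟨z, hz, hz'⟩ := Metric.mem_closure_iff.1 hy _ (Nat.one_div_pos_of_nat (n := n))
    obtain ⟨α, hα⟩ := Set.mem_iUnion.1 hz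
    exact ⟨α, z, hα, hz'⟩
  have : Nonempty A := ⟨(hx 0 0).choose⟩
  choose a z hz hdz using hx
  obtain ⟨c, hcb⟩ := aux_bounded hd hc (ι := D × ℕ) (by
    rw [mk_prod, lift_uzero, mk_nat, lift_aleph0]
    exact mul_le_of_le hτ hDτ hτ) (fun p => a (f p.1) p.2)
  refine ⟨c, ?_⟩
  have hDc : D ⊆ f ⁻¹' (F c : Set X) := by
    intro d hdD
    change f d ∈ (F c : Set X)
    rw [← (hcl c).closure_eq, Metric.mem_closure_iff]
    intro ε hε
    obtain ⟨n, hn⟩ := exists_nat_one_div_lt hε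
    exact ⟨z (f d) n, hm (hcb (⟨d, hdD⟩, n)) (hz _ _), (hdz _ _).trans hn⟩
  have hcont : Continuous f :=
    AddMonoidHomClass.continuous_of_bound f 1 (fun y => by
      simpa using NonUnitalStarAlgHom.norm_apply_le f y)
  rintro _ ⟨y, rfl⟩
  exact closure_minimal hDc ((hcl c).preimage hcont) (hD y)
end
end

section
/- Let τ be an infinite cardinal, let X and Y be unital C*-algebras, let A be a τ-complete directed poset, and let (X_α)_{α∈A} and (Y_α)_{α∈A} be direct C*_τ-systems of subalgebras of X and of Y, respectively, with the same indexing poset A. Then for every unital *-homomorphism f : X → Y there exists a cofinal and τ-closed subset A_f ⊆ A such that f(X_α) ⊆ Y_α for every α ∈ A_f (equivalently, for each α ∈ A_f the restriction of f induces a unital *-homomorphism f_α : X_α → Y_α commuting with the inclusions, and f is the limit of this morphism of subsystems). -/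
universe u v

open Cardinal Set

noncomputable section

theorem aux_bdd {τ : Cardinal.{u}} (hτ : ℵ₀ ≤ τ) {A : Type u} [PartialOrder A] [Nonempty A]
    (hd : ∀ a b : A, ∃ c, a ≤ c ∧ b ≤ c) (hc : TauComplete A τ) :
    ∀ κ : Cardinal.{u}, κ ≤ τ → ∀ S : Set A, #S = κ → BddAbove S := by
  have : IsDirectedOrder A := ⟨hd⟩
  intro κ
  induction κ using WellFoundedLT.induction with
  | ind κ ih =>
    intro hκ S hS
    by_cases hfin : S.Finite
    · exact hfin.bddAbove
    have hinf : ℵ₀ ≤ κ := by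
      rw [← hS]
      exact Cardinal.infinite_iff.1 (Set.infinite_coe_iff.2 hfin)
    have hSne : S.Nonempty := Set.Infinite.nonempty hfin
    obtain ⟨r, wo, hr⟩ := Cardinal.exists_ord_eq S
    have hcard : ∀ i : S, #{j : S // r j i} < κ := by
      intro i
      rw [← hS]
      exact Cardinal.card_typein_lt i hr
    classical
    let b : S → A := wo.wf.fix (fun i rec =>
      if h : BddAbove (insert (i : A) (Set.range fun j : {j : S // r j i} => rec j.1 j.2))
      then h.choose else (i : A))
    have hb : ∀ i : S, (i : A) ≤ b i ∧ ∀ j, r j i → b j ≤ b i := by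
      intro i
      have h : BddAbove (insert (i : A) (Set.range fun j : {j : S // r j i} => b j.1)) := by
        refine ih _ ?_ ?_ _ rfl
        · refine (Cardinal.mk_insert_le).trans_lt ?_
          exact Cardinal.add_lt_of_lt hinf (Cardinal.mk_range_le.trans_lt (hcard i))
            (Cardinal.one_lt_aleph0.trans_le hinf)
        · refine (Cardinal.mk_insert_le).trans ?_
          exact (Cardinal.add_lt_of_lt hinf (Cardinal.mk_range_le.trans_lt (hcard i))
            (Cardinal.one_lt_aleph0.trans_le hinf)).le.trans hκ
      have e : b i = h.choose := by
        have := wo.wf.fix_eq (fun i rec =>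
          if h : BddAbove (insert (i : A) (Set.range fun j : {j : S // r j i} => rec j.1 j.2))
          then h.choose else (i : A)) i
        exact this.trans (dif_pos h)
      have hs := h.choose_spec
      rw [e]
      exact ⟨hs (Set.mem_insert _ _), fun j hj => hs (Set.mem_insert_of_mem _ ⟨⟨j, hj⟩, rfl⟩)⟩
    obtain ⟨s, hs⟩ := hc (Set.range b) (by
      rintro _ ⟨i, rfl⟩ _ ⟨j, rfl⟩ hne
      rcases trichotomous_of r i j with h | h | h
      · exact Or.inl ((hb j).2 i h)
      · exact absurd (congrArg b h) hne
      · exact Or.inr ((hb i).2 j h)) (by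
      obtain ⟨x, hx⟩ := hSne
      exact ⟨_, ⟨x, hx⟩, rfl⟩) (Cardinal.mk_range_le.trans (hS.le.trans hκ))
    exact ⟨s, fun x hx => (hb ⟨x, hx⟩).1.trans (hs.1 ⟨_, rfl⟩)⟩

/-- Let `(A, FX)` and `(A, FY)` be direct C*_τ-systems of
subalgebras of unital C*-algebras `X` and `Y` with the same indexing poset.
Then every unital `*`-homomorphism `f : X → Y` maps `FX α` into `FY α` for all
`α` in some cofinal τ-closed subset of `A`. -/
theorem exists_cofinal_tauClosed_mapsTo {X Y : Type u} [CStarAlgebra X] [CStarAlgebra Y]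
    {τ : Cardinal.{u}} (hτ : ℵ₀ ≤ τ)
    {A : Type u} [PartialOrder A]
    {FX : A → StarSubalgebra ℂ X} (hFX : IsDirectCSystem τ A FX)
    {FY : A → StarSubalgebra ℂ Y} (hFY : IsDirectCSystem τ A FY)
    (f : X →⋆ₐ[ℂ] Y) :
    ∃ Af : Set A, CofinalIn Af ∧ TauClosed τ Af ∧
      ∀ α ∈ Af, ∀ x ∈ FX α, f x ∈ FY α := by
  obtain ⟨hd, hc, -, hXm, hXd, hXs, -⟩ := hFX
  obtain ⟨-, -, hYc, hYm, -, -, hYu⟩ := hFY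
  have hf : Continuous f :=
    AddMonoidHomClass.continuous_of_bound f 1 fun x => by
      simpa using NonUnitalStarAlgHom.norm_apply_le f x
  have key : ∀ (S : Set X) (β : A), (∀ x ∈ S, f x ∈ FY β) → ∀ x ∈ closure S, f x ∈ FY β := by
    intro S β h x hx
    exact closure_minimal (t := f ⁻¹' (FY β : Set Y)) h ((hYc β).preimage hf) hx
  refine ⟨{α | ∀ x ∈ FX α, f x ∈ FY α}, ?_, ?_, fun α h => h⟩
  · intro a
    have : Nonempty A := ⟨a⟩
    have bdd : ∀ S : Set A, #S ≤ τ → BddAbove S := fun S h => aux_bdd hτ hd hc _ h S rfl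
    have hy : ∀ y : Y, ∃ α, y ∈ FY α := by
      intro y
      have : y ∈ closure (⋃ α : A, (FY α : Set Y)) := by rw [hYu]; trivial
      obtain ⟨u, hu, hlim⟩ := mem_closure_iff_seq_limit.1 this
      have hu' : ∀ n, ∃ α, u n ∈ FY α := fun n => by simpa using hu n
      choose g hg using hu'
      obtain ⟨β, hβ⟩ := bdd (Set.range g)
        ((Cardinal.mk_le_aleph0_iff.2 (Set.countable_range g).to_subtype).trans hτ)
      exact ⟨β, (hYc β).mem_of_tendsto hlim
        (Filter.Eventually.of_forall fun n => hYm (hβ ⟨n, rfl⟩) (hg n))⟩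
    choose g hg using hy
    have hh : ∀ α : A, ∃ β, α ≤ β ∧ ∀ x ∈ FX α, f x ∈ FY β := by
      intro α
      obtain ⟨D, -, hDτ, hD⟩ := hXd α
      obtain ⟨β, hβ⟩ := bdd ((fun d => g (f d)) '' D) (Cardinal.mk_image_le.trans hDτ)
      obtain ⟨γ, h1, h2⟩ := hd α β
      refine ⟨γ, h1, fun x hx => key D γ (fun d hdD => ?_) x (hD hx)⟩
      exact hYm ((hβ ⟨d, hdD, rfl⟩).trans h2) (hg (f d))
    choose h h1 h2 using hh
    let s : ℕ → A := fun n => h^[n] a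
    have hsucc : ∀ n, s (n+1) = h (s n) := fun n => Function.iterate_succ_apply' h n a
    have hmono : Monotone s := monotone_nat_of_le_succ fun n => by rw [hsucc]; exact h1 _
    have hch : IsChain (· ≤ ·) (Set.range s) := hmono.isChain_range
    have hct : #(Set.range s) ≤ τ :=
      (Cardinal.mk_le_aleph0_iff.2 (Set.countable_range s).to_subtype).trans hτ
    obtain ⟨t, ht⟩ := hc _ hch (Set.range_nonempty s) hct
    refine ⟨t, ?_, ht.1 ⟨0, rfl⟩⟩
    intro x hx
    have hx' : x ∈ (FX t : Set X) := hx
    rw [hXs _ hch (Set.range_nonempty s) hct t ht] at hx'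
    refine key _ t ?_ x hx'
    intro z hz
    simp only [Set.mem_iUnion] at hz
    obtain ⟨_, ⟨n, rfl⟩, hz⟩ := hz
    exact hYm (ht.1 ⟨n+1, hsucc n⟩) (h2 _ z hz)
  · intro C hC hch hne hcard s hs x hx
    have hx' : x ∈ (FX s : Set X) := hx
    rw [hXs C hch hne hcard s hs] at hx'
    refine key _ s ?_ x hx'
    intro z hz
    simp only [Set.mem_iUnion] at hz
    obtain ⟨β, hβ, hz⟩ := hz
    exact hYm (hs.1 hβ) (hC hβ z hz)
end
end

section
/- Let τ be an infinite cardinal, let X and Y be unital C*-algebras, let A be a τ-complete directed poset, and let (X_α)_{α∈A} and (Y_α)_{α∈A} be direct C*_τ-systems of subalgebras of X and of Y, respectively, with the same indexing poset A. If f : X → Y is a unital *-isomorphism, then there exists a cofinal and τ-closed subset A_f ⊆ A such that f(X_α) = Y_α for every α ∈ A_f; in particular, for each α ∈ A_f the restriction of f is a unital *-isomorphism of X_α onto Y_α. -/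
universe u v

open Cardinal Set

noncomputable section

theorem exists_ub {A : Type u} [PartialOrder A] {τ : Cardinal.{u}}
    (hd : ∀ a b : A, ∃ c, a ≤ c ∧ b ≤ c) (hc : TauComplete A τ) [Nonempty A]
    {ι : Type u} (s : ι → A) (hι : #ι ≤ τ) : ∃ u, ∀ i, s i ≤ u := by
  classical
  obtain ⟨r, wo⟩ := exists_wellOrder ι
  have key : ∀ (S : Set ι) (g : ι → A), (∀ i ∈ S, ∀ j ∈ S, i < j → g i ≤ g j) →
      ∃ u, ∀ i ∈ S, g i ≤ u := by
    intro S g hg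
    rcases S.eq_empty_or_nonempty with rfl | hS
    · exact ⟨Classical.arbitrary A, by simp⟩
    obtain ⟨u, hu⟩ := hc (g '' S) (by
      rintro _ ⟨i, hi, rfl⟩ _ ⟨j, hj, rfl⟩ hne
      rcases lt_trichotomy i j with h | h | h
      · exact Or.inl (hg i hi j hj h)
      · exact absurd (by rw [h]) hne
      · exact Or.inr (hg j hj i hi h)) (hS.image g)
      ((mk_image_le).trans ((mk_set_le S).trans hι))
    exact ⟨u, fun i hi => hu.1 ⟨i, hi, rfl⟩⟩
  have hwf : WellFounded ((· < ·) : ι → ι → Prop) := wellFounded_lt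
  let F : ∀ i : ι, (∀ j, j < i → A) → A := fun i p =>
    if h : ∃ u, s i ≤ u ∧ ∀ j (hj : j < i), p j hj ≤ u then h.choose else Classical.arbitrary A
  let g : ι → A := hwf.fix F
  have hg : ∀ i, g i = F i (fun j _ => g j) := fun i => hwf.fix_eq F i
  have main : ∀ i, s i ≤ g i ∧ ∀ j, j < i → g j ≤ g i := by
    intro i
    induction i using hwf.induction with
    | _ i ih =>
      obtain ⟨u, hu⟩ := key (Set.Iio i) g (fun a _ b hb hab => (ih b hb).2 a hab)
      obtain ⟨c, hc1, hc2⟩ := hd (s i) u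
      have h : ∃ u, s i ≤ u ∧ ∀ j (hj : j < i), g j ≤ u :=
        ⟨c, hc1, fun j hj => (hu j hj).trans hc2⟩
      have e : g i = h.choose := by
        rw [hg i]; exact dif_pos h
      rw [e]; exact h.choose_spec
  obtain ⟨u, hu⟩ := key Set.univ g (fun a _ b _ hab => (main b).2 a hab)
  exact ⟨u, fun i => (main i).1.trans (hu i trivial)⟩

theorem mem_some {X : Type u} [CStarAlgebra X] {τ : Cardinal.{u}} (hτ : ℵ₀ ≤ τ)
    {A : Type u} [PartialOrder A] [Nonempty A]
    {FX : A → StarSubalgebra ℂ X} (hFX : IsDirectCSystem τ A FX) (x : X) :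
    ∃ a, x ∈ FX a := by
  obtain ⟨hd, hc, hcl, hm, -, -, hdense⟩ := hFX
  have hx : x ∈ closure (⋃ α : A, (FX α : Set X)) := by rw [hdense]; trivial
  obtain ⟨w, hw, hlim⟩ := mem_closure_iff_seq_limit.1 hx
  have hw' : ∀ n, ∃ a, w n ∈ FX a := fun n => by simpa using hw n
  choose a ha using hw'
  obtain ⟨u, hu⟩ := exists_ub hd hc (fun n : ULift.{u} ℕ => a n.down) (by simpa using hτ)
  exact ⟨u, (hcl u).mem_of_tendsto hlim (Filter.Eventually.of_forall
    fun n => hm (hu ⟨n⟩) (ha n))⟩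

theorem exists_step {X Y : Type u} [CStarAlgebra X] [CStarAlgebra Y]
    {τ : Cardinal.{u}} (hτ : ℵ₀ ≤ τ) {A : Type u} [PartialOrder A]
    {FX : A → StarSubalgebra ℂ X} (hFX : IsDirectCSystem τ A FX)
    {FY : A → StarSubalgebra ℂ Y} (hFY : IsDirectCSystem τ A FY)
    (f : X → Y) (hf : Continuous f) (a : A) :
    ∃ b, ∀ x ∈ FX a, f x ∈ FY b := by
  haveI : Nonempty A := ⟨a⟩
  obtain ⟨D, hD, hDc, hDd⟩ := hFX.2.2.2.2.1 a
  choose b hb using fun x => mem_some hτ hFY (f x)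
  obtain ⟨u, hu⟩ := exists_ub hFY.1 hFY.2.1 (fun d : D => b d) hDc
  refine ⟨u, fun x hx => ?_⟩
  have h1 : IsClosed (f ⁻¹' (FY u : Set Y)) := (hFY.2.2.1 u).preimage hf
  have h2 : D ⊆ f ⁻¹' (FY u : Set Y) := fun d hd => hFY.2.2.2.1 (hu ⟨d, hd⟩) (hb d)
  exact closure_minimal h2 h1 (hDd hx)

/-- Let `(A, FX)` and `(A, FY)` be direct C*_τ-systems of
subalgebras of unital C*-algebras `X` and `Y` with the same indexing poset.
If `f : X ≃ Y` is a unital `*`-isomorphism, then `f` maps `FX α` *onto* `FY α`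
for all `α` in some cofinal τ-closed subset of `A`; in particular `f` restricts
to a `*`-isomorphism of `FX α` onto `FY α` for each such `α`. -/
theorem exists_cofinal_tauClosed_image_eq {X Y : Type u} [CStarAlgebra X] [CStarAlgebra Y]
    {τ : Cardinal.{u}} (hτ : ℵ₀ ≤ τ)
    {A : Type u} [PartialOrder A]
    {FX : A → StarSubalgebra ℂ X} (hFX : IsDirectCSystem τ A FX)
    {FY : A → StarSubalgebra ℂ Y} (hFY : IsDirectCSystem τ A FY)
    (f : X ≃⋆ₐ[ℂ] Y) :
    ∃ Af : Set A, CofinalIn Af ∧ TauClosed τ Af ∧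
      ∀ α ∈ Af, ⇑f '' (FX α : Set X) = (FY α : Set Y) := by
  have hf : Continuous f := (StarAlgEquiv.isometry f).continuous
  have hfs : Continuous f.symm := (StarAlgEquiv.isometry f.symm).continuous
  let e : X ≃ₜ Y := ⟨f.toEquiv, hf, hfs⟩
  have he : ∀ S : Set X, f '' closure S = closure (f '' S) := fun S => e.image_closure S
  refine ⟨{α | ⇑f '' (FX α : Set X) = (FY α : Set Y)}, ?_, ?_, fun α h => h⟩
  · intro a
    have step : ∀ a : A, ∃ b, a ≤ b ∧ (∀ x ∈ FX a, f x ∈ FY b) ∧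
        (∀ y ∈ FY a, f.symm y ∈ FX b) := by
      intro a
      obtain ⟨b, hb⟩ := exists_step hτ hFX hFY f hf a
      obtain ⟨c, hc⟩ := exists_step hτ hFY hFX f.symm hfs a
      obtain ⟨d, hbd, hcd⟩ := hFX.1 b c
      obtain ⟨k, hdk, hak⟩ := hFX.1 d a
      exact ⟨k, hak, fun x hx => hFY.2.2.2.1 (hbd.trans hdk) (hb x hx),
        fun y hy => hFX.2.2.2.1 (hcd.trans hdk) (hc y hy)⟩
    choose g hg1 hg2 hg3 using step
    let s : ℕ → A := fun n => g^[n] a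
    have hs : ∀ n, s (n + 1) = g (s n) := fun n => Function.iterate_succ_apply' g n a
    have hmono : Monotone s := monotone_nat_of_le_succ fun n => by rw [hs]; exact hg1 _
    have hch : IsChain (· ≤ ·) (range s) := hmono.isChain_range
    have hne : (range s).Nonempty := ⟨_, 0, rfl⟩
    have hcard : #(range s) ≤ τ := (Set.countable_range s).le_aleph0.trans hτ
    obtain ⟨u, hu⟩ := hFX.2.1 (range s) hch hne hcard
    refine ⟨u, ?_, hu.1 ⟨0, rfl⟩⟩
    have h1 := hFX.2.2.2.2.2.1 _ hch hne hcard u hu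
    have h2 := hFY.2.2.2.2.2.1 _ hch hne hcard u hu
    show f '' _ = _
    rw [h1, h2, he]
    congr 1
    apply Subset.antisymm
    · rintro _ ⟨x, hx, rfl⟩
      simp only [mem_iUnion, mem_range, exists_prop, exists_exists_eq_and, SetLike.mem_coe] at hx ⊢
      obtain ⟨n, hn⟩ := hx
      exact ⟨n + 1, by rw [hs]; exact hg2 _ x hn⟩
    · intro y hy
      refine ⟨f.symm y, ?_, f.apply_symm_apply y⟩
      simp only [mem_iUnion, mem_range, exists_prop, exists_exists_eq_and, SetLike.mem_coe] at hy ⊢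
      obtain ⟨n, hn⟩ := hy
      exact ⟨n + 1, by rw [hs]; exact hg3 _ y hn⟩
  · intro C hC hch hne hcard s hs
    show f '' _ = _
    rw [hFX.2.2.2.2.2.1 C hch hne hcard s hs, hFY.2.2.2.2.2.1 C hch hne hcard s hs, he]
    congr 1
    simp only [image_iUnion]
    exact iUnion₂_congr fun b hb => hC hb
end
end

section
/- Every doubly projective unital *-homomorphism i : X → Y of unital C*-algebras is a coretraction: there exists a unital *-homomorphism r : Y → X such that r ∘ i = id_X. In particular, every doubly projective homomorphism is injective. -/
universe u v

open Cardinal Set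

noncomputable section

/-- A unital `*`-homomorphism `i : X → Y` is *doubly projective* if for every
surjective unital `*`-homomorphism `p : A → B` of unital C*-algebras and all
unital `*`-homomorphisms `f : X → A`, `g : Y → B` with `g ∘ i = p ∘ f` there is
a unital `*`-homomorphism `h : Y → A` with `h ∘ i = f` and `p ∘ h = g`. -/
def DoublyProjective {X Y : Type u} [Ring X] [StarRing X] [Algebra ℂ X]
    [Ring Y] [StarRing Y] [Algebra ℂ Y] (i : X →⋆ₐ[ℂ] Y) : Prop :=
  ∀ (A B : Type u) [CStarAlgebra A] [CStarAlgebra B] (p : A →⋆ₐ[ℂ] B),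
    Function.Surjective p →
      ∀ (f : X →⋆ₐ[ℂ] A) (g : Y →⋆ₐ[ℂ] B), g.comp i = p.comp f →
        ∃ h : Y →⋆ₐ[ℂ] A, h.comp i = f ∧ p.comp h = g

/-- Every doubly projective unital `*`-homomorphism
`i : X → Y` of unital C*-algebras is a coretraction: there is a unital
`*`-homomorphism `r : Y → X` with `r ∘ i = id`.  In particular `i` is
injective. -/
theorem doublyProjective_coretraction {X Y : Type u} [CStarAlgebra X] [CStarAlgebra Y]
    (i : X →⋆ₐ[ℂ] Y) (hi : DoublyProjective i) :
    (∃ r : Y →⋆ₐ[ℂ] X, r.comp i = StarAlgHom.id ℂ X) ∧ Function.Injective i := by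
  -- the terminal object: the zero algebra, realised as functions on the empty type
  let zX : X →⋆ₐ[ℂ] (Empty → X) :=
    { toFun := fun _ e => e.elim
      map_one' := Subsingleton.elim _ _
      map_mul' := fun _ _ => Subsingleton.elim _ _
      map_zero' := Subsingleton.elim _ _
      map_add' := fun _ _ => Subsingleton.elim _ _
      commutes' := fun _ => Subsingleton.elim _ _
      map_star' := fun _ => Subsingleton.elim _ _ }
  let zY : Y →⋆ₐ[ℂ] (Empty → X) :=
    { toFun := fun _ e => e.elim
      map_one' := Subsingleton.elim _ _
      map_mul' := fun _ _ => Subsingleton.elim _ _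
      map_zero' := Subsingleton.elim _ _
      map_add' := fun _ _ => Subsingleton.elim _ _
      commutes' := fun _ => Subsingleton.elim _ _
      map_star' := fun _ => Subsingleton.elim _ _ }
  obtain ⟨r, hr, -⟩ := hi X (Empty → X) zX (fun b => ⟨0, Subsingleton.elim _ _⟩)
    (StarAlgHom.id ℂ X) zY (StarAlgHom.ext fun x => Subsingleton.elim _ _)
  refine ⟨⟨r, hr⟩, fun a b hab => ?_⟩
  have ha : r (i a) = a := DFunLike.congr_fun hr a
  have hb : r (i b) = b := DFunLike.congr_fun hr b
  rw [← ha, ← hb, hab]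
end
end

section
/- Let i : X → Y be a doubly projective unital *-homomorphism of unital C*-algebras. Then X is projective if and only if Y is projective. -/
universe u v

open Cardinal Set

noncomputable section

/-- A unital C*-algebra `P` is *projective* if every unital `*`-homomorphism
from `P` into a quotient lifts: for every surjective unital `*`-homomorphism
`p : A → B` of unital C*-algebras and every unital `*`-homomorphism
`f : P → B` there is a unital `*`-homomorphism `g : P → A` with `p ∘ g = f`. -/
def IsProjective (P : Type u) [Ring P] [StarRing P] [Algebra ℂ P] : Prop :=
  ∀ (A B : Type u) [CStarAlgebra A] [CStarAlgebra B] (p : A →⋆ₐ[ℂ] B),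
    Function.Surjective p → ∀ f : P →⋆ₐ[ℂ] B, ∃ g : P →⋆ₐ[ℂ] A, p.comp g = f

/-- If `i : X → Y` is a doubly projective unital
`*`-homomorphism of unital C*-algebras, then `X` is projective if and only if
`Y` is projective. -/
theorem isProjective_iff_of_doublyProjective {X Y : Type u} [CStarAlgebra X] [CStarAlgebra Y]
    (i : X →⋆ₐ[ℂ] Y) (hi : DoublyProjective i) :
    IsProjective X ↔ IsProjective Y := by
  constructor
  · intro hX A B _ _ p hp g
    obtain ⟨f, hf⟩ := hX A B p hp (g.comp i)
    obtain ⟨h, -, hh⟩ := hi A B p hp f g hf.symm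
    exact ⟨h, hh⟩
  · intro hY A B _ _ p hp f
    -- the zero algebra as functions on the empty type
    let zX : X →⋆ₐ[ℂ] (PEmpty.{u+1} → ℂ) :=
      { toFun := fun _ => 0
        map_one' := Subsingleton.elim _ _
        map_mul' := fun _ _ => Subsingleton.elim _ _
        map_zero' := Subsingleton.elim _ _
        map_add' := fun _ _ => Subsingleton.elim _ _
        commutes' := fun _ => Subsingleton.elim _ _
        map_star' := fun _ => Subsingleton.elim _ _ }
    let zY : Y →⋆ₐ[ℂ] (PEmpty.{u+1} → ℂ) :=
      { toFun := fun _ => 0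
        map_one' := Subsingleton.elim _ _
        map_mul' := fun _ _ => Subsingleton.elim _ _
        map_zero' := Subsingleton.elim _ _
        map_add' := fun _ _ => Subsingleton.elim _ _
        commutes' := fun _ => Subsingleton.elim _ _
        map_star' := fun _ => Subsingleton.elim _ _ }
    obtain ⟨r, hr, -⟩ := hi X (PEmpty.{u+1} → ℂ) zX
      (fun b => ⟨0, Subsingleton.elim _ _⟩) (StarAlgHom.id ℂ X) zY
      (StarAlgHom.ext fun _ => Subsingleton.elim _ _)
    obtain ⟨k, hk⟩ := hY A B p hp (f.comp r)
    refine ⟨k.comp i, ?_⟩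
    rw [← StarAlgHom.comp_assoc, hk, StarAlgHom.comp_assoc, hr, StarAlgHom.comp_id]
end
end

section
/- (1) If a unital C*-algebra X admits a unital *-homomorphism into ℂ and Y is a closed unital *-subalgebra of X, then Y admits a unital *-homomorphism into ℂ. (2) Every projective unital C*-algebra admits a unital *-homomorphism into ℂ. -/
universe u v

open Cardinal Set

noncomputable section

/-- (1) If a unital C*-algebra `X` admits a unital
`*`-homomorphism into `ℂ` and `S` is a closed unital `*`-subalgebra of `X`,
then `S` admits a unital `*`-homomorphism into `ℂ`.  (2) Every projective
unital C*-algebra admits a unital `*`-homomorphism into `ℂ`. -/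
theorem exists_starAlgHom_to_complex :
    (∀ (X : Type u) [CStarAlgebra X] (S : StarSubalgebra ℂ X), IsClosed (S : Set X) →
      Nonempty (X →⋆ₐ[ℂ] ℂ) → Nonempty (↥S →⋆ₐ[ℂ] ℂ)) ∧
    (∀ (P : Type u) [CStarAlgebra P], IsProjective P → Nonempty (P →⋆ₐ[ℂ] ℂ)) := by
  refine ⟨fun X _ S _ ⟨φ⟩ => ⟨φ.comp S.subtype⟩, fun P _ hP => ?_⟩
  obtain ⟨g, -⟩ := hP (P × ℂ) P (StarAlgHom.fst ℂ P ℂ) Prod.fst_surjective (StarAlgHom.id ℂ P)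
  exact ⟨(StarAlgHom.snd ℂ P ℂ).comp g⟩
end
end

section
/- Let f : X → Y be a unital *-homomorphism between projective unital C*-algebras. Then the following are equivalent: (a) f is doubly projective; (b) f is a projective object of the category of unital *-homomorphisms of unital C*-algebras, i.e., for all unital *-homomorphisms p : A → B and q : C → D, all surjective unital *-homomorphisms s : A → C and r : B → D with q ∘ s = r ∘ p, and all unital *-homomorphisms α : X → C and β : Y → D with q ∘ α = β ∘ f, there exist unital *-homomorphisms α' : X → A and β' : Y → B such that p ∘ α' = β' ∘ f, s ∘ α' = α, and r ∘ β' = β. -/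
universe u v

open Cardinal Set

noncomputable section

/-- A unital `*`-homomorphism `f : X → Y` of projective
unital C*-algebras is doubly projective if and only if it is a projective
object of the category of unital `*`-homomorphisms of unital C*-algebras. -/
theorem doublyProjective_iff_projective_morphism {X Y : Type u}
    [CStarAlgebra X] [CStarAlgebra Y]
    (hX : IsProjective X) (hY : IsProjective Y) (f : X →⋆ₐ[ℂ] Y) :
    DoublyProjective f ↔
      (∀ (A B C D : Type u) [CStarAlgebra A] [CStarAlgebra B] [CStarAlgebra C] [CStarAlgebra D]
        (p : A →⋆ₐ[ℂ] B) (q : C →⋆ₐ[ℂ] D) (s : A →⋆ₐ[ℂ] C) (r : B →⋆ₐ[ℂ] D),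
        Function.Surjective s → Function.Surjective r → q.comp s = r.comp p →
          ∀ (α : X →⋆ₐ[ℂ] C) (β : Y →⋆ₐ[ℂ] D), q.comp α = β.comp f →
            ∃ (α' : X →⋆ₐ[ℂ] A) (β' : Y →⋆ₐ[ℂ] B),
              p.comp α' = β'.comp f ∧ s.comp α' = α ∧ r.comp β' = β) := by
  constructor
  · intro hf A B C D _ _ _ _ p q s r hs hr hsq α β hαβ
    obtain ⟨α', hα'⟩ := hX A C s hs α
    have h : β.comp f = r.comp (p.comp α') := by
      rw [← hαβ, ← hα', ← StarAlgHom.comp_assoc, hsq, StarAlgHom.comp_assoc]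
    obtain ⟨β', h1, h2⟩ := hf B D r hr (p.comp α') β h
    exact ⟨α', β', h1.symm, hα', h2⟩
  · intro H A B _ _ p hp u g hg
    obtain ⟨α', β', h1, h2, h3⟩ := H X A X B u (p.comp u) (StarAlgHom.id ℂ X) p
      Function.surjective_id hp (StarAlgHom.comp_id _) (StarAlgHom.id ℂ X) g
      ((StarAlgHom.comp_id _).trans hg.symm)
    rw [StarAlgHom.id_comp] at h2
    subst h2
    exact ⟨β', h1.symm.trans (StarAlgHom.comp_id _), h3⟩
end
end

section
/- Let X be a projective unital C*-algebra of density τ > ℵ₀. Then there exists a direct C*_ℵ₀-system of subalgebras (A, (X_α)_{α∈A}) of X such that each X_α is a separable projective unital C*-subalgebra of X; moreover, the indexing poset A may be taken to be a cofinal and ℵ₀-closed subset of the poset exp_ℵ₀ τ of all countable subsets of τ ordered by inclusion. -/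
universe u v

open Cardinal Set

noncomputable section

/-- The density of a topological space: the least cardinality of a dense
subset. -/
def density (X : Type u) [TopologicalSpace X] : Cardinal.{u} :=
  ⨅ D : {D : Set X // Dense D}, #D.1


open scoped CStarAlgebra BoundedContinuousFunction

theorem core_lift {X : Type u} [CStarAlgebra X] (hX : IsProjective X)
    {I : Type u} [Preorder I] [TopologicalSpace I] [DiscreteTopology I]
    (hI : ∀ s : ℕ → I, ∃ b, ∀ n, s n ≤ b)
    (K : I → StarSubalgebra ℂ X) (hK : Monotone K) (hc : ∀ i, IsClosed (K i : Set X))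
    (hcov : ∀ x : X, ∃ i, x ∈ K i) :
    ∃ g : I → (X →⋆ₐ[ℂ] X), (∀ i x, g i x ∈ K i) ∧ ∀ x, ∃ i, ∀ j, i ≤ j → g j x = x := by
  classical
  have h2 : ∀ i j : I, ∃ k, i ≤ k ∧ j ≤ k := by
    intro i j
    obtain ⟨b, hb⟩ := hI (fun n => if n = 0 then i else j)
    exact ⟨b, by simpa using hb 0, by simpa using hb 1⟩
  have hne : Nonempty I := ⟨(hcov 0).choose⟩
  let E : StarSubalgebra ℂ (X × (I →ᵇ X)) :=
    { carrier := {φ | (∀ i, φ.2 i ∈ K i) ∧ ∃ i, ∀ j, i ≤ j → φ.2 j = φ.1}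
      mul_mem' := by
        rintro φ ψ ⟨h1, i, hi⟩ ⟨h1', i', hi'⟩
        obtain ⟨k, hk, hk'⟩ := h2 i i'
        refine ⟨fun i => mul_mem (h1 i) (h1' i), k, fun j hj => ?_⟩
        simp [hi j (hk.trans hj), hi' j (hk'.trans hj)]
      add_mem' := by
        rintro φ ψ ⟨h1, i, hi⟩ ⟨h1', i', hi'⟩
        obtain ⟨k, hk, hk'⟩ := h2 i i'
        refine ⟨fun i => add_mem (h1 i) (h1' i), k, fun j hj => ?_⟩
        simp [hi j (hk.trans hj), hi' j (hk'.trans hj)]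
      algebraMap_mem' := by
        intro r
        exact ⟨fun i => algebraMap_mem (K i) r, hne.some, fun j hj => rfl⟩
      star_mem' := by
        rintro φ ⟨h1, i, hi⟩
        refine ⟨fun i => star_mem (h1 i), i, fun j hj => ?_⟩
        simp [hi j hj] }
  have hEc : IsClosed (E : Set (X × (I →ᵇ X))) := by
    apply IsSeqClosed.isClosed
    intro φ ψ hφ hlim
    have hev : ∀ i, Filter.Tendsto (fun n => (φ n).2 i) Filter.atTop (nhds (ψ.2 i)) := fun i =>
      (((show Continuous (fun φ : I →ᵇ X => φ i) from by fun_prop).comp continuous_snd).tendsto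
        ψ).comp hlim
    have h1 : Filter.Tendsto (fun n => (φ n).1) Filter.atTop (nhds ψ.1) :=
      (continuous_fst.tendsto ψ).comp hlim
    refine ⟨fun i => (hc i).mem_of_tendsto (hev i) (Filter.Eventually.of_forall fun n => (hφ n).1 i), ?_⟩
    choose s hs using fun n => (hφ n).2
    obtain ⟨b, hb⟩ := hI s
    refine ⟨b, fun j hj => tendsto_nhds_unique (hev j) ?_⟩
    have : (fun n => (φ n).2 j) = fun n => (φ n).1 := by
      funext n; exact hs n j ((hb n).trans hj)
    rw [this]; exact h1
  haveI := hEc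
  let p : E →⋆ₐ[ℂ] X := (StarAlgHom.fst ℂ X (I →ᵇ X)).comp E.subtype
  have hp : Function.Surjective p := by
    intro x
    obtain ⟨i, hi⟩ := hcov x
    let φ : I →ᵇ X := BoundedContinuousFunction.ofNormedAddCommGroupDiscrete
      (fun j => if i ≤ j then x else 0) ‖x‖ (by intro j; split_ifs <;> simp)
    have hφ : ((x, φ) : X × (I →ᵇ X)) ∈ E := by
      refine ⟨fun j => ?_, i, fun j hj => ?_⟩
      · change (if i ≤ j then x else 0) ∈ K j
        split_ifs with h
        · exact hK h hi
        · exact zero_mem _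
      · change (if i ≤ j then x else 0) = x
        simp [hj]
    exact ⟨⟨_, hφ⟩, rfl⟩
  obtain ⟨g, hg⟩ := hX E X p hp (StarAlgHom.id ℂ X)
  let ev : ∀ i : I, (I →ᵇ X) →⋆ₐ[ℂ] X := fun i =>
    { toFun := fun φ => φ i
      map_one' := rfl
      map_mul' := fun _ _ => rfl
      map_zero' := rfl
      map_add' := fun _ _ => rfl
      commutes' := fun _ => rfl
      map_star' := fun _ => rfl }
  refine ⟨fun i => ((ev i).comp (StarAlgHom.snd ℂ X (I →ᵇ X))).comp (E.subtype.comp g),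
    fun i x => (g x).2.1 i, fun x => ?_⟩
  obtain ⟨i, hi⟩ := (g x).2.2
  exact ⟨i, fun j hj => (hi j hj).trans (DFunLike.congr_fun hg x)⟩

theorem proj_of_retract {X : Type u} [CStarAlgebra X] (hX : IsProjective X)
    (K : StarSubalgebra ℂ X) (g : X →⋆ₐ[ℂ] X) (hg : ∀ x, g x ∈ K) (hid : ∀ x ∈ K, g x = x) :
    IsProjective K := by
  intro A B _ _ p hp f
  obtain ⟨h, hh⟩ := hX A B p hp (f.comp (g.codRestrict K hg))
  refine ⟨h.comp K.subtype, ?_⟩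
  ext x
  have := DFunLike.congr_fun hh (x : X)
  refine Eq.trans this ?_
  change f _ = f x
  congr 1
  exact Subtype.ext (hid x x.2)

theorem sep_adjoin {X : Type u} [CStarAlgebra X] (s : Set X) (hs : s.Countable) :
    TopologicalSpace.IsSeparable ((StarAlgebra.adjoin ℂ s : StarSubalgebra ℂ X) : Set X) := by
  have hs' : (s ∪ star s).Countable := by
    refine hs.union ?_
    rw [← Set.image_star]
    exact hs.image _
  have hm : ((Submonoid.closure (s ∪ star s) : Submonoid X) : Set X).Countable := by
    haveI : Countable ↥(s ∪ star s) := hs'.to_subtype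
    rw [Submonoid.closure_eq_mrange]
    haveI : Countable (FreeMonoid ↥(s ∪ star s)) :=
      inferInstanceAs (Countable (List ↥(s ∪ star s)))
    exact Set.countable_range _
  have h := hm.isSeparable.span (R := ℂ)
  rw [← StarAlgebra.adjoin_eq_span] at h
  exact h

/-- closed subalgebra generated by the values of `d` on `S` -/
def Gen {X : Type u} [CStarAlgebra X] {ι : Type u} (d : ι → X) (S : Set ι) : StarSubalgebra ℂ X :=
  (StarAlgebra.adjoin ℂ (d '' S)).topologicalClosure

theorem Gen_mono {X : Type u} [CStarAlgebra X] {ι : Type u} (d : ι → X) : Monotone (Gen d) :=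
  fun _ _ h => StarSubalgebra.topologicalClosure_mono (StarAlgebra.adjoin_mono (Set.image_mono h))

theorem Gen_closed {X : Type u} [CStarAlgebra X] {ι : Type u} (d : ι → X) (S : Set ι) :
    IsClosed (Gen d S : Set X) := StarSubalgebra.isClosed_topologicalClosure _

theorem mem_Gen {X : Type u} [CStarAlgebra X] {ι : Type u} (d : ι → X) {S : Set ι} {t : ι}
    (ht : t ∈ S) : d t ∈ Gen d S :=
  StarSubalgebra.le_topologicalClosure _ (StarAlgebra.subset_adjoin ℂ _ (Set.mem_image_of_mem d ht))

theorem Gen_sep {X : Type u} [CStarAlgebra X] {ι : Type u} (d : ι → X) (S : Set ι)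
    (hS : S.Countable) :
    ∃ D : Set X, D ⊆ (Gen d S : Set X) ∧ D.Countable ∧ (Gen d S : Set X) ⊆ closure D := by
  have h : TopologicalSpace.IsSeparable (Gen d S : Set X) := by
    unfold Gen
    rw [StarSubalgebra.topologicalClosure_coe]
    exact (sep_adjoin _ (hS.image d)).closure
  obtain ⟨D, hD, hDc, hcl⟩ := h.exists_countable_dense_subset
  exact ⟨D, hD, hDc, hcl⟩

theorem Gen_sUnion {X : Type u} [CStarAlgebra X] {ι : Type u} (d : ι → X) (C : Set (Set ι))
    (hC : IsChain (· ≤ ·) C) (hne : C.Nonempty) :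
    (Gen d (⋃₀ C) : Set X) ⊆ closure (⋃ S ∈ C, (Gen d S : Set X)) := by
  unfold Gen
  rw [StarSubalgebra.topologicalClosure_coe]
  refine closure_mono ?_
  intro x hx
  have key : ∀ x ∈ StarAlgebra.adjoin ℂ (d '' (⋃₀ C)), ∃ S ∈ C, x ∈ Gen d S := by
    intro x hx
    have h2 : ∀ S ∈ C, ∀ T ∈ C, ∃ U ∈ C, S ≤ U ∧ T ≤ U := by
      intro S hS T hT
      rcases hC.total hS hT with h | h
      · exact ⟨T, hT, h, le_rfl⟩
      · exact ⟨S, hS, le_rfl, h⟩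
    induction hx using StarAlgebra.adjoin_induction with
    | mem x h =>
      obtain ⟨t, ⟨S, hS, ht⟩, rfl⟩ := h
      exact ⟨S, hS, mem_Gen d ht⟩
    | algebraMap r =>
      obtain ⟨S, hS⟩ := hne
      exact ⟨S, hS, algebraMap_mem _ r⟩
    | add x y _ _ hx hy =>
      obtain ⟨S, hS, hx⟩ := hx
      obtain ⟨T, hT, hy⟩ := hy
      obtain ⟨U, hU, h, h'⟩ := h2 S hS T hT
      exact ⟨U, hU, add_mem (Gen_mono d h hx) (Gen_mono d h' hy)⟩
    | mul x y _ _ hx hy =>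
      obtain ⟨S, hS, hx⟩ := hx
      obtain ⟨T, hT, hy⟩ := hy
      obtain ⟨U, hU, h, h'⟩ := h2 S hS T hT
      exact ⟨U, hU, mul_mem (Gen_mono d h hx) (Gen_mono d h' hy)⟩
    | star x _ hx =>
      obtain ⟨S, hS, hx⟩ := hx
      exact ⟨S, hS, star_mem hx⟩
  obtain ⟨S, hS, h⟩ := key x hx
  exact Set.mem_biUnion hS h

theorem Gen_eq {X : Type u} [CStarAlgebra X] {ι : Type u} (d : ι → X) (C : Set (Set ι))
    (hC : IsChain (· ≤ ·) C) (hne : C.Nonempty) :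
    (Gen d (⋃₀ C) : Set X) = closure (⋃ S ∈ C, (Gen d S : Set X)) := by
  refine (Gen_sUnion d C hC hne).antisymm (closure_minimal ?_ (Gen_closed d _))
  exact Set.iUnion₂_subset fun S hS => Gen_mono d (Set.subset_sUnion_of_mem hS)

theorem exists_dense_family {X : Type u} [TopologicalSpace X] {τ : Cardinal.{u}}
    (h : density X = τ) : ∃ d : τ.out → X, DenseRange d := by
  haveI : Nonempty {D : Set X // Dense D} := ⟨⟨Set.univ, dense_univ⟩⟩
  obtain ⟨D, hD⟩ := ciInf_mem (fun D : {D : Set X // Dense D} => #D.1)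
  have h1 : #D.1 = τ := hD.trans h
  have h2 : #τ.out = #D.1 := by rw [h1, Cardinal.mk_out]
  obtain ⟨e⟩ := Cardinal.eq.1 h2
  refine ⟨fun t => (e t : X), ?_⟩
  have : Set.range (fun t => (e t : X)) = D.1 := by
    rw [show (fun t => (e t : X)) = Subtype.val ∘ e from rfl, e.surjective.range_comp]
    exact Subtype.range_coe
  unfold DenseRange
  rw [this]
  exact D.2

theorem isLUB_union {ι : Type u} (C : Set {S : Set ι // S.Countable}) (hC : C.Countable) :
    ∃ s : {S : Set ι // S.Countable}, s.1 = ⋃₀ (Subtype.val '' C) ∧ IsLUB C s := by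
  refine ⟨⟨⋃₀ (Subtype.val '' C), ?_⟩, rfl, ?_, ?_⟩
  · refine (hC.image _).sUnion ?_
    rintro _ ⟨S, _, rfl⟩
    exact S.2
  · intro S hS
    exact Set.subset_sUnion_of_mem (Set.mem_image_of_mem _ hS)
  · intro T hT
    refine Set.sUnion_subset ?_
    rintro _ ⟨S, hS, rfl⟩
    exact hT hS

theorem exists_direct_omega_system_of_projective {X : Type u} [CStarAlgebra X]
    (hX : IsProjective X) {τ : Cardinal.{u}} (hτ : ℵ₀ < τ) (hdens : density X = τ) :
    ∃ 𝒜 : Set {S : Set τ.out // S.Countable},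
      CofinalIn 𝒜 ∧ TauClosed ℵ₀ 𝒜 ∧
      ∃ F : ↥𝒜 → StarSubalgebra ℂ X,
        IsDirectCSystem ℵ₀ ↥𝒜 F ∧ ∀ a : ↥𝒜, IsProjective ↥(F a) := by
  obtain ⟨d, hd⟩ := exists_dense_family hdens
  let I := {S : Set τ.out // S.Countable}
  letI : TopologicalSpace I := ⊥
  haveI : DiscreteTopology I := ⟨rfl⟩
  have hI : ∀ s : ℕ → I, ∃ b : I, ∀ n, s n ≤ b := fun s =>
    ⟨⟨⋃ n, (s n).1, Set.countable_iUnion fun n => (s n).2⟩,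
      fun n => Set.subset_iUnion (fun n => (s n).1) n⟩
  let K : I → StarSubalgebra ℂ X := fun S => Gen d S.1
  have hK : Monotone K := fun S T h => Gen_mono d h
  have hcov : ∀ x : X, ∃ i, x ∈ K i := by
    intro x
    obtain ⟨u, hu, hlim⟩ := mem_closure_iff_seq_limit.1 (hd x)
    choose t ht using hu
    refine ⟨⟨Set.range t, Set.countable_range t⟩, ?_⟩
    refine (Gen_closed d _).mem_of_tendsto hlim (Filter.Eventually.of_forall fun n => ?_)
    rw [← ht n]
    exact mem_Gen d ⟨n, rfl⟩
  obtain ⟨g, hgK, hg⟩ := core_lift hX hI K hK (fun i => Gen_closed d _) hcov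
  have hfix : ∀ i, IsClosed {x | g i x = x} := fun i =>
    isClosed_eq (map_continuous (g i)) continuous_id
  let 𝒜 : Set I := {S | ∀ T, S ≤ T → ∀ x ∈ K S, g T x = x}
  have hunion : ∀ C : Set I, C.Countable → IsChain (· ≤ ·) C → C.Nonempty → ∀ s : I, IsLUB C s →
      (K s : Set X) = closure (⋃ S ∈ C, (K S : Set X)) := by
    intro C hCc hC hne s hs
    obtain ⟨s', hs', hl⟩ := isLUB_union C hCc
    obtain rfl := hs.unique hl
    change (Gen d s.1 : Set X) = _
    rw [hs', Gen_eq d _ (by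
      rintro _ ⟨S, hS, rfl⟩ _ ⟨T, hT, rfl⟩ hST
      exact hC hS hT (fun h => hST (by rw [h]))) (hne.image _), Set.biUnion_image]
  have hcountC : ∀ {α : Type u} (C : Set α), #C ≤ ℵ₀ → C.Countable := fun C h =>
    Cardinal.le_aleph0_iff_set_countable.1 h
  have hclosed : TauClosed ℵ₀ 𝒜 := by
    intro C hCA hC hne hcard s hs T hT
    have h := hunion C (hcountC C hcard) hC hne s hs
    intro x hx
    have hx' : x ∈ (K s : Set X) := hx
    rw [h] at hx'
    refine closure_minimal ?_ (hfix T) hx'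
    exact Set.iUnion₂_subset fun S hS y hy => hCA hS T ((hs.1 hS).trans hT) y hy
  have hstep : ∀ S : I, ∃ S' : I, S ≤ S' ∧ ∀ T, S' ≤ T → ∀ x ∈ K S, g T x = x := by
    intro S
    obtain ⟨D, hDK, hDc, hD⟩ := Gen_sep d S.1 S.2
    choose i hi using hg
    haveI := hDc.to_subtype
    refine ⟨⟨S.1 ∪ ⋃ x ∈ D, (i x).1, S.2.union (hDc.biUnion fun x _ => (i x).2)⟩,
      Set.subset_union_left, fun T hT x hx => ?_⟩
    refine closure_minimal ?_ (hfix T) (hD hx)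
    intro y hy
    refine hi y T (le_trans ?_ hT)
    exact (Set.subset_biUnion_of_mem (u := fun x => (i x).1) hy).trans Set.subset_union_right
  have hcof : CofinalIn 𝒜 := by
    intro S
    choose nx hle hnx using hstep
    let s : ℕ → I := fun n => nx^[n] S
    have hsucc : ∀ n, s (n + 1) = nx (s n) := fun n => Function.iterate_succ_apply' nx n S
    have hmono : Monotone s := monotone_nat_of_le_succ fun n => by rw [hsucc]; exact hle _
    obtain ⟨b, -, hb⟩ := isLUB_union (Set.range s) (Set.countable_range s)
    refine ⟨b, ?_, hb.1 ⟨0, rfl⟩⟩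
    intro T hT x hx
    have hx' : x ∈ (K b : Set X) := hx
    rw [hunion (Set.range s) (Set.countable_range s) hmono.isChain_range
      (Set.range_nonempty s) b hb] at hx'
    refine closure_minimal ?_ (hfix T) hx'
    refine Set.iUnion₂_subset ?_
    rintro _ ⟨n, rfl⟩ y hy
    refine hnx (s n) T ?_ y hy
    rw [← hsucc]
    exact (hb.1 ⟨n + 1, rfl⟩).trans hT
  -- suprema in `𝒜`
  have hsup : ∀ C : Set 𝒜, IsChain (· ≤ ·) C → C.Nonempty → #C ≤ ℵ₀ →
      ∃ s : 𝒜, IsLUB C s ∧ IsLUB (Subtype.val '' C) s.1 := by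
    intro C hC hne hcard
    have hc := (hcountC C hcard).image (Subtype.val : 𝒜 → I)
    obtain ⟨s, -, hs⟩ := isLUB_union _ hc
    have hch : IsChain (· ≤ ·) (Subtype.val '' C) := by
      rintro _ ⟨S, hS, rfl⟩ _ ⟨T, hT, rfl⟩ hST
      exact hC hS hT (fun h => hST (by rw [h]))
    have hsA : s ∈ 𝒜 := hclosed _ (by rintro _ ⟨S, _, rfl⟩; exact S.2) hch (hne.image _)
      (Cardinal.le_aleph0_iff_set_countable.2 hc) s hs
    refine ⟨⟨s, hsA⟩, ⟨fun S hS => hs.1 ⟨S, hS, rfl⟩, fun T hT => hs.2 ?_⟩, hs⟩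
    rintro _ ⟨S, hS, rfl⟩
    exact hT hS
  refine ⟨𝒜, hcof, hclosed, fun a => K a.1, ⟨?_, ?_, ?_, ?_, ?_, ?_, ?_⟩, ?_⟩
  · intro a b
    obtain ⟨c, hc, h⟩ := hcof ⟨a.1.1 ∪ b.1.1, a.1.2.union b.1.2⟩
    exact ⟨⟨c, hc⟩, Set.subset_union_left.trans h, Set.subset_union_right.trans h⟩
  · intro C hC hne hcard
    obtain ⟨s, hs, -⟩ := hsup C hC hne hcard
    exact ⟨s, hs⟩
  · exact fun a => Gen_closed d _
  · exact fun a b h => hK h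
  · intro a
    obtain ⟨D, h1, h2, h3⟩ := Gen_sep d a.1.1 a.1.2
    exact ⟨D, h1, Cardinal.le_aleph0_iff_set_countable.2 h2, h3⟩
  · intro C hC hne hcard s hs
    obtain ⟨s', hs', hl⟩ := hsup C hC hne hcard
    obtain rfl := hs.unique hs'
    have hch : IsChain (· ≤ ·) (Subtype.val '' C) := by
      rintro _ ⟨S, hS, rfl⟩ _ ⟨T, hT, rfl⟩ hST
      exact hC hS hT (fun h => hST (by rw [h]))
    have := hunion _ ((hcountC C hcard).image _) hch (hne.image _) s.1 hl
    rw [Set.biUnion_image] at this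
    exact this
  · refine Set.eq_univ_of_univ_subset ?_
    rw [← hd.closure_range]
    refine closure_mono ?_
    rintro _ ⟨t, rfl⟩
    obtain ⟨b, hb, h⟩ := hcof ⟨{t}, Set.countable_singleton t⟩
    exact Set.mem_iUnion.2 ⟨⟨b, hb⟩, mem_Gen d (h rfl)⟩
  · intro a
    exact proj_of_retract hX _ (g a.1) (hgK a.1) (a.2 a.1 le_rfl)
end
end

section
/- Let X be a unital C*-algebra of density τ > ℵ₀. Then X is projective if and only if there exists a direct C*_ℵ₀-system of subalgebras (A, (X_α)_{α∈A}) of X such that each X_α is a separable projective unital C*-subalgebra of X and, for each α ∈ A, the inclusion homomorphism X_α ↪ X is doubly projective. -/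
universe u v

open Cardinal Set

noncomputable section

lemma exists_norm_le_lift {A B : Type u} [CStarAlgebra A] [CStarAlgebra B] (p : A →⋆ₐ[ℂ] B)
    (hp : Function.Surjective p) (b : B) : ∃ a, p a = b ∧ ‖a‖ ≤ ‖b‖ := by
  obtain ⟨a, rfl⟩ := hp b
  rcases eq_or_ne (p a) 0 with h0 | h0
  · exact ⟨0, by simp [h0], by simp⟩
  set r := ‖p a‖ with hr
  have hr0 : 0 < r := norm_pos_iff.2 h0
  let f : ℝ → ℝ := fun t => r / max r (Real.sqrt t)
  have hf : Continuous f := by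
    refine continuous_const.div (by fun_prop) fun t => ?_
    exact (lt_max_of_lt_left hr0).ne'
  have hpc : Continuous p := AddMonoidHomClass.continuous_of_bound p 1
    (by simpa using NonUnitalStarAlgHom.norm_apply_le p)
  have hsa : IsSelfAdjoint (star a * a) := .star_mul_self a
  have hsb : IsSelfAdjoint (star (p a) * p a) := .star_mul_self _
  have h1 : p (cfc f (star a * a)) = 1 := by
    rw [StarAlgHom.map_cfc p f (star a * a) hf.continuousOn hpc hsa (by rw [map_mul, map_star]; exact hsb)]
    rw [map_mul, map_star]
    rw [cfc_congr (g := fun _ => 1), cfc_const_one ℝ _ ]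
    intro t ht
    have h2 : ‖t‖ ≤ r ^ 2 := by
      have := spectrum.norm_le_norm_mul_of_mem ht
      rcases subsingleton_or_nontrivial B with hB | hB
      · exact absurd (Subsingleton.elim _ _) h0
      simpa [CStarRing.norm_star_mul_self, ← hr, ← sq] using this
    have h3 : Real.sqrt t ≤ r := Real.sqrt_le_iff.2 ⟨hr0.le, (le_abs_self t).trans h2⟩
    simp [f, max_eq_left h3, hr0.ne']
  refine ⟨a * cfc f (star a * a), by rw [map_mul, h1, mul_one], ?_⟩
  have hfs : IsSelfAdjoint (cfc f (star a * a)) := cfc_predicate f _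
  refine abs_le_of_sq_le_sq' ?_ hr0.le |>.2
  rw [sq, ← CStarRing.norm_star_mul_self, star_mul, hfs.star_eq]
  have h4 : cfc f (star a * a) * star a * (a * cfc f (star a * a)) =
      cfc (fun t => f t * t * f t) (star a * a) := by
    rw [cfc_mul (fun t => f t * t) f (star a * a) (by fun_prop) (by fun_prop),
      cfc_mul f (fun t => t) (star a * a) (by fun_prop) (by fun_prop), cfc_id' ℝ (star a * a)]
    simp only [mul_assoc]
  rw [h4]
  refine norm_cfc_le (by positivity) fun t ht => ?_
  have ht0 : 0 ≤ t := spectrum_star_mul_self_nonneg t ht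
  have hm : 0 < max r (Real.sqrt t) := lt_max_of_lt_left hr0
  have : t ≤ max r (Real.sqrt t) ^ 2 := by
    conv_lhs => rw [← Real.sq_sqrt ht0]
    gcongr
    exact le_max_right _ _
  rw [Real.norm_of_nonneg (by positivity)]
  simp only [f]
  rw [div_mul_eq_mul_div, div_mul_div_comm, div_le_iff₀ (by positivity)]
  nlinarith [sq_nonneg r, mul_le_mul_of_nonneg_left this (sq_nonneg r)]

instance lpC {I : Type u} {A : I → Type u} [∀ i, CStarAlgebra (A i)] [∀ i, Nontrivial (A i)] :
  CStarAlgebra (lp A ⊤) where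

def lpEv {I : Type u} {A : I → Type u} [∀ i, CStarAlgebra (A i)] [∀ i, Nontrivial (A i)] (i : I) :
   lp A ⊤ →⋆ₐ[ℂ] A i where
   toFun f := f i
   map_one' := rfl
   map_mul' _ _ := rfl
   map_zero' := rfl
   map_add' _ _ := rfl
   commutes' _ := rfl
   map_star' _ := rfl

lemma sep {X : Type u} [CStarAlgebra X] (S : Set X) (hS : S.Countable) :
   TopologicalSpace.IsSeparable ((StarAlgebra.adjoin ℂ S).topologicalClosure : Set X) := by
  rw [StarSubalgebra.topologicalClosure_coe]
  refine TopologicalSpace.IsSeparable.closure ?_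
  have h : ((StarAlgebra.adjoin ℂ S : StarSubalgebra ℂ X) : Set X) = Submodule.span ℂ (Submonoid.closure (S ∪ star S) : Set X) := by
    rw [← Algebra.adjoin_eq_span]
    rfl
  rw [h]
  refine TopologicalSpace.IsSeparable.span ?_
  refine Set.Countable.isSeparable ?_
  have : (S ∪ star S).Countable := hS.union (by rw [← Set.image_star]; exact hS.image _)
  have := this.to_subtype
  rw [Submonoid.closure_eq_mrange]
  exact countable_range _ 

lemma sah_cont {A B : Type u} [CStarAlgebra A] [CStarAlgebra B] (p : A →⋆ₐ[ℂ] B) : Continuous p :=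
  AddMonoidHomClass.continuous_of_bound p 1 (by simpa using NonUnitalStarAlgHom.norm_apply_le p)

/-- evaluation of formal star polynomials -/
def fev {X B : Type u} [CStarAlgebra B] (b : X → B) : FreeAlgebra ℂ (X ⊕ X) →ₐ[ℂ] B :=
  FreeAlgebra.lift ℂ (Sum.elim b (fun i => star (b i)))

lemma fev_comp {X A B : Type u} [CStarAlgebra A] [CStarAlgebra B] (φ : A →⋆ₐ[ℂ] B) (b : X → A)
    (a : FreeAlgebra ℂ (X ⊕ X)) : φ (fev b a) = fev (fun i => φ (b i)) a := by
  have : (φ : A →ₐ[ℂ] B).comp (fev b) = fev (fun i => φ (b i)) := by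
    ext (i | i)
    · simp [fev]
    · simpa [fev] using! map_star φ (b i)
  exact DFunLike.congr_fun this a

lemma mem_adjoin_fev {X B : Type u} [CStarAlgebra B] (b : X → B) {z : B}
    (hz : z ∈ StarAlgebra.adjoin ℂ (range b)) : ∃ a, fev b a = z := by
  have hz' : z ∈ Algebra.adjoin ℂ (range b ∪ star (range b)) := hz
  induction hz' using Algebra.adjoin_induction with
  | mem x hx =>
    rcases hx with ⟨i, rfl⟩ | ⟨i, hi⟩
    · exact ⟨FreeAlgebra.ι ℂ (Sum.inl i), by simp [fev]⟩
    · exact ⟨FreeAlgebra.ι ℂ (Sum.inr i), by simp [fev, hi]⟩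
  | algebraMap r => exact ⟨algebraMap _ _ r, by simp⟩
  | add x y hx hy h1 h2 =>
    obtain ⟨a, rfl⟩ := h1 hx
    obtain ⟨c, rfl⟩ := h2 hy
    exact ⟨a + c, by simp⟩
  | mul x y hx hy h1 h2 =>
    obtain ⟨a, rfl⟩ := h1 hx
    obtain ⟨c, rfl⟩ := h2 hy
    exact ⟨a * c, by simp⟩

/-- extension along graph -/
lemma graph_ext {X L B : Type u} [CStarAlgebra L] [CStarAlgebra B] (x : X → L) (b : X → B)
    (h : ∀ a, ‖fev b a‖ ≤ ‖fev x a‖) :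
    ∃ ψ : (StarAlgebra.adjoin ℂ (range x)).topologicalClosure →⋆ₐ[ℂ] B,
      ∀ i hi, ψ ⟨x i, hi⟩ = b i := by
  let w : X → L × B := fun i => (x i, b i)
  let G := (StarAlgebra.adjoin ℂ (range w)).topologicalClosure
  have hG : IsClosed (G : Set (L × B)) := StarSubalgebra.isClosed_topologicalClosure _
  have hle : ∀ z ∈ G, ‖z.2‖ ≤ ‖z.1‖ := by
    have hc : IsClosed {z : L × B | ‖z.2‖ ≤ ‖z.1‖} :=
      isClosed_le (by fun_prop) (by fun_prop)
    intro z hz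
    refine closure_minimal ?_ hc hz
    intro y hy
    obtain ⟨a, rfl⟩ := mem_adjoin_fev w hy
    have h1 := fev_comp (StarAlgHom.fst ℂ L B) w a
    have h2 := fev_comp (StarAlgHom.snd ℂ L B) w a
    change (fev w a).1 = fev x a at h1
    change (fev w a).2 = fev b a at h2
    change ‖(fev w a).2‖ ≤ ‖(fev w a).1‖
    rw [h1, h2]
    exact h a
  have huniq : ∀ p b₁ b₂, (p, b₁) ∈ G → (p, b₂) ∈ G → b₁ = b₂ := by
    intro p b₁ b₂ h1 h2
    have := hle _ (sub_mem h1 h2)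
    simpa [sub_eq_zero] using this
  have hw : ∀ i, w i ∈ G := fun i =>
    StarSubalgebra.le_topologicalClosure _ (StarAlgebra.subset_adjoin ℂ _ ⟨i, rfl⟩)
  have hex : ∀ p ∈ (StarAlgebra.adjoin ℂ (range x)).topologicalClosure, ∃ c, (p, c) ∈ G := by
    have : CompleteSpace G := hG.completeSpace_coe
    let π : G →⋆ₐ[ℂ] L := (StarAlgHom.fst ℂ L B).comp G.subtype
    have hiso : Isometry π := by
      refine AddMonoidHomClass.isometry_of_norm π fun z => ?_
      change ‖z.1.1‖ = ‖z.1‖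
      rw [Prod.norm_def, max_eq_left (hle _ z.2)]
    have hcl : IsClosed (π.range : Set L) := by
      have := hiso.isClosedEmbedding.isClosed_range
      exact this
    have : (StarAlgebra.adjoin ℂ (range x)).topologicalClosure ≤ π.range := by
      refine StarSubalgebra.topologicalClosure_minimal ?_ hcl
      refine StarAlgebra.adjoin_le ?_
      rintro _ ⟨i, rfl⟩
      exact ⟨⟨w i, hw i⟩, rfl⟩
    intro p hp
    obtain ⟨z, rfl⟩ := this hp
    exact ⟨z.1.2, z.2⟩
  choose F hF using hex
  refine ⟨{ toFun := fun p => F p.1 p.2, map_one' := ?_, map_mul' := ?_, map_zero' := ?_, map_add' := ?_, commutes' := ?_, map_star' := ?_ }, ?_⟩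
  · exact huniq _ _ _ (hF _ _) (one_mem G)
  · intro p q
    exact huniq _ _ _ (hF _ _) (mul_mem (hF _ p.2) (hF _ q.2))
  · exact huniq _ _ _ (hF _ _) (zero_mem G)
  · intro p q
    exact huniq _ _ _ (hF _ _) (add_mem (hF _ p.2) (hF _ q.2))
  · intro r
    exact huniq _ _ _ (hF _ _) (algebraMap_mem G r)
  · intro p
    exact huniq _ _ _ (hF _ _) (star_mem (hF _ p.2))
  · intro i hi
    exact huniq _ _ _ (hF _ _) (hw i)

def FIdx (X : Type u) (r : X → ℝ) : Type u :=
  {N : FreeAlgebra ℂ (X ⊕ X) → ℝ // ∃ (B : Type u) (_ : CStarAlgebra B) (_ : Nontrivial B)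
    (b : X → B), (∀ i, ‖b i‖ ≤ r i) ∧ ∀ a, N a = ‖fev b a‖}

theorem exists_free (X : Type u) (r : X → ℝ) (hr : ∀ i, 0 ≤ r i) :
    ∃ (P : Type u) (_ : CStarAlgebra P) (x : X → P), (∀ i, ‖x i‖ ≤ r i) ∧
      (StarAlgebra.adjoin ℂ (range x)).topologicalClosure = ⊤ ∧
      ∀ (B : Type u) [CStarAlgebra B] (b : X → B), (∀ i, ‖b i‖ ≤ r i) →
        ∃ ψ : P →⋆ₐ[ℂ] B, ∀ i, ψ (x i) = b i := by
  have hall : ∀ N : FIdx X r, ∃ (B : Type u) (_ : CStarAlgebra B) (_ : Nontrivial B)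
    (b : X → B), (∀ i, ‖b i‖ ≤ r i) ∧ ∀ a, N.1 a = ‖fev b a‖ := fun N => N.2
  choose A iA nA b hb hN using hall
  let y : X → lp A ⊤ := fun i => ⟨fun N => b N i, memℓp_infty ⟨r i, by
    rintro _ ⟨N, rfl⟩
    exact hb N i⟩⟩
  have hy : ∀ i, ‖y i‖ ≤ r i := fun i => lp.norm_le_of_forall_le (hr i) fun N => hb N i
  let P := (StarAlgebra.adjoin ℂ (range y)).topologicalClosure
  have hP : IsClosed (P : Set (lp A ⊤)) := StarSubalgebra.isClosed_topologicalClosure _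
  have hyP : ∀ i, y i ∈ P := fun i =>
    StarSubalgebra.le_topologicalClosure _ (StarAlgebra.subset_adjoin ℂ _ ⟨i, rfl⟩)
  refine ⟨P, inferInstance, fun i => ⟨y i, hyP i⟩, hy, ?_, ?_⟩
  · rw [eq_top_iff]
    rintro ⟨z, hz⟩ -
    have key : ∀ z ∈ StarAlgebra.adjoin ℂ (range y), ∀ hz : z ∈ P,
        (⟨z, hz⟩ : P) ∈ StarAlgebra.adjoin ℂ (range fun i => (⟨y i, hyP i⟩ : P)) := by
      intro z hz
      have : StarAlgebra.adjoin ℂ (range y) ≤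
          (StarAlgebra.adjoin ℂ (range fun i => (⟨y i, hyP i⟩ : P))).map P.subtype := by
        refine StarAlgebra.adjoin_le ?_
        rintro _ ⟨i, rfl⟩
        exact ⟨⟨y i, hyP i⟩, StarAlgebra.subset_adjoin ℂ _ ⟨i, rfl⟩, rfl⟩
      obtain ⟨q, hq, rfl⟩ := this hz
      intro _
      exact hq
    change (⟨z, hz⟩ : P) ∈ closure _
    rw [closure_subtype]
    refine closure_mono ?_ (show z ∈ closure (StarAlgebra.adjoin ℂ (range y) : Set (lp A ⊤)) from hz)
    intro v hv
    exact ⟨⟨v, StarSubalgebra.le_topologicalClosure _ hv⟩, key v hv _, rfl⟩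
  · intro B _ c hc
    let c' : X → B × ℂ := fun i => (c i, 0)
    let N : FIdx X r := ⟨fun a => ‖fev c' a‖, B × ℂ, inferInstance, inferInstance, c',
      fun i => by simpa [c', Prod.norm_def] using hc i, fun _ => rfl⟩
    obtain ⟨ψ, hψ⟩ := graph_ext y c' (by
      intro a
      rw [show ‖fev c' a‖ = N.1 a from rfl, hN]
      have := fev_comp (lpEv N) y a
      change (fev y a) N = fev (b N) a at this
      rw [← this]
      exact lp.norm_apply_le_norm (by simp) _ _)
    refine ⟨(StarAlgHom.fst ℂ B ℂ).comp ψ, fun i => ?_⟩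
    change (ψ ⟨y i, _⟩).1 = c i
    rw [hψ]

/-- closed star subalgebra generated by the family on `S` -/
def gen {X P : Type u} [CStarAlgebra P] (x : X → P) (S : Set X) : StarSubalgebra ℂ P :=
  (StarAlgebra.adjoin ℂ (x '' S)).topologicalClosure

lemma gen_closed {X P : Type u} [CStarAlgebra P] (x : X → P) (S : Set X) :
    IsClosed (gen x S : Set P) := StarSubalgebra.isClosed_topologicalClosure _

lemma gen_mono {X P : Type u} [CStarAlgebra P] (x : X → P) : Monotone (gen x) := fun _ _ h =>
  StarSubalgebra.topologicalClosure_mono (StarAlgebra.adjoin_mono (image_mono h))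

lemma mem_gen {X P : Type u} [CStarAlgebra P] (x : X → P) {S : Set X} {i : X} (hi : i ∈ S) :
    x i ∈ gen x S :=
  StarSubalgebra.le_topologicalClosure _ (StarAlgebra.subset_adjoin ℂ _ ⟨i, hi, rfl⟩)

lemma gen_le {X P : Type u} [CStarAlgebra P] (x : X → P) {S : Set X} {T : StarSubalgebra ℂ P}
    (hT : IsClosed (T : Set P)) (h : ∀ i ∈ S, x i ∈ T) : gen x S ≤ T := by
  refine StarSubalgebra.topologicalClosure_minimal (StarAlgebra.adjoin_le ?_) hT
  rintro _ ⟨i, hi, rfl⟩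
  exact h i hi

lemma exists_countable_gen {X P : Type u} [CStarAlgebra P] (x : X → P)
    (hx : (StarAlgebra.adjoin ℂ (range x)).topologicalClosure = ⊤) (z : P) :
    ∃ T : Set X, T.Countable ∧ z ∈ gen x T := by
  have hz : z ∈ closure (StarAlgebra.adjoin ℂ (range x) : Set P) := by
    have : z ∈ (StarAlgebra.adjoin ℂ (range x)).topologicalClosure := by rw [hx]; trivial
    exact this
  have key : ∀ y ∈ StarAlgebra.adjoin ℂ (range x), ∃ T : Set X, T.Countable ∧ y ∈ gen x T := by
    intro y hy
    induction hy using StarAlgebra.adjoin_induction with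
    | mem y hy =>
      obtain ⟨i, rfl⟩ := hy
      exact ⟨{i}, countable_singleton i, mem_gen x rfl⟩
    | algebraMap r => exact ⟨∅, countable_empty, algebraMap_mem _ r⟩
    | add a b _ _ ha hb =>
      obtain ⟨S, hS, ha⟩ := ha
      obtain ⟨T, hT, hb⟩ := hb
      exact ⟨S ∪ T, hS.union hT, add_mem (gen_mono x subset_union_left ha)
        (gen_mono x subset_union_right hb)⟩
    | mul a b _ _ ha hb =>
      obtain ⟨S, hS, ha⟩ := ha
      obtain ⟨T, hT, hb⟩ := hb
      exact ⟨S ∪ T, hS.union hT, mul_mem (gen_mono x subset_union_left ha)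
        (gen_mono x subset_union_right hb)⟩
    | star a _ ha =>
      obtain ⟨S, hS, ha⟩ := ha
      exact ⟨S, hS, star_mem ha⟩
  obtain ⟨y, hy, hyz⟩ := mem_closure_iff_seq_limit.1 hz
  choose T hT hyT using fun n => key (y n) (hy n)
  refine ⟨⋃ n, T n, countable_iUnion hT, ?_⟩
  exact (gen_closed x _).mem_of_tendsto hyz
    (Filter.Eventually.of_forall fun n => gen_mono x (subset_iUnion T n) (hyT n))

/-- Two star homs which agree through `q` on generators. -/
lemma agree {X P B : Type u} [CStarAlgebra X] [CStarAlgebra P] [CStarAlgebra B]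
    (x : X → P) (q : P →⋆ₐ[ℂ] X) (hq : ∀ i, q (x i) = i) (S : Set X)
    (f : gen (id : X → X) S →⋆ₐ[ℂ] B) (ψ : P →⋆ₐ[ℂ] B)
    (h : ∀ i (hi : i ∈ S), ψ (x i) = f ⟨i, mem_gen id hi⟩) :
    ∀ z ∈ gen x S, ∀ hz : q z ∈ gen (id : X → X) S, ψ z = f ⟨q z, hz⟩ := by
  have hcl := gen_closed (id : X → X) S
  have hfc : Continuous f := sah_cont f
  have hle : gen x S ≤ (gen (id : X → X) S).comap q := by
    refine gen_le x (hcl.preimage (sah_cont q)) fun i hi => ?_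
    change q (x i) ∈ gen (id : X → X) S
    rw [hq]
    exact mem_gen id hi
  let q' : gen x S →⋆ₐ[ℂ] gen (id : X → X) S :=
    (q.comp (gen x S).subtype).codRestrict _ fun z => hle z.2
  have hq'c : Continuous q' := by
    refine Continuous.subtype_mk ((sah_cont q).comp continuous_subtype_val) _
  have heq : ψ.comp (gen x S).subtype = f.comp q' := by
    refine StarAlgHom.ext_topologicalClosure ((sah_cont ψ).comp continuous_subtype_val)
      (hfc.comp hq'c) ?_
    refine StarAlgHom.ext fun z => ?_
    refine StarAlgebra.adjoin_induction_subtype (p := fun z => ((ψ.comp (gen x S).subtype).comp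
      (StarSubalgebra.inclusion (StarSubalgebra.le_topologicalClosure _))) z =
      ((f.comp q').comp
      (StarSubalgebra.inclusion (StarSubalgebra.le_topologicalClosure _))) z) z ?_ ?_ ?_ ?_ ?_
    · rintro _ ⟨i, hi, rfl⟩
      change ψ (x i) = f ⟨q (x i), _⟩
      rw [h i hi]
      congr 2
      exact (hq i).symm
    · intro r
      simp only [AlgHomClass.commutes]
    · intro a b ha hb
      simp only [map_add, ha, hb]
    · intro a b ha hb
      simp only [map_mul, ha, hb]
    · intro a ha
      simp only [map_star, ha]
  intro z hz hqz
  exact DFunLike.congr_fun heq ⟨z, hz⟩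

lemma gen_chain {X : Type u} [CStarAlgebra X] (C : Set (Set X)) (hne : C.Nonempty)
    (hC : IsChain (· ⊆ ·) C) :
    (gen (id : X → X) (⋃₀ C) : Set X) = closure (⋃ S ∈ C, (gen (id : X → X) S : Set X)) := by
  apply subset_antisymm
  · refine closure_mono ?_
    intro z hz
    have key : ∃ S ∈ C, z ∈ gen (id : X → X) S := by
      have hz' : z ∈ StarAlgebra.adjoin ℂ ((id : X → X) '' (⋃₀ C)) := hz
      clear hz
      have two : ∀ S ∈ C, ∀ T ∈ C, ∃ U ∈ C, S ⊆ U ∧ T ⊆ U := by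
        intro S hS T hT
        rcases hC.total hS hT with h | h
        · exact ⟨T, hT, h, subset_rfl⟩
        · exact ⟨S, hS, subset_rfl, h⟩
      induction hz' using StarAlgebra.adjoin_induction with
      | mem y hy =>
        obtain ⟨i, ⟨S, hS, hi⟩, rfl⟩ := hy
        exact ⟨S, hS, mem_gen id hi⟩
      | algebraMap r =>
        obtain ⟨S, hS⟩ := hne
        exact ⟨S, hS, algebraMap_mem _ r⟩
      | add a b _ _ ha hb =>
        obtain ⟨S, hS, ha⟩ := ha
        obtain ⟨T, hT, hb⟩ := hb
        obtain ⟨U, hU, h1, h2⟩ := two S hS T hT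
        exact ⟨U, hU, add_mem (gen_mono _ h1 ha) (gen_mono _ h2 hb)⟩
      | mul a b _ _ ha hb =>
        obtain ⟨S, hS, ha⟩ := ha
        obtain ⟨T, hT, hb⟩ := hb
        obtain ⟨U, hU, h1, h2⟩ := two S hS T hT
        exact ⟨U, hU, mul_mem (gen_mono _ h1 ha) (gen_mono _ h2 hb)⟩
      | star a _ ha =>
        obtain ⟨S, hS, ha⟩ := ha
        exact ⟨S, hS, star_mem ha⟩
    obtain ⟨S, hS, h⟩ := key
    exact mem_biUnion hS h
  · refine closure_minimal ?_ (gen_closed _ _)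
    refine iUnion₂_subset fun S hS => gen_mono _ (subset_sUnion_of_mem hS)

/-- closing off a set -/
lemma exists_closed_countable {X : Type u} (T : X → Set X) (hT : ∀ i, (T i).Countable) (j : X) :
    ∃ S : Set X, S.Countable ∧ j ∈ S ∧ ∀ i ∈ S, T i ⊆ S := by
  let W : ℕ → Set X := fun n => Nat.rec {j} (fun _ S => S ∪ ⋃ i ∈ S, T i) n
  have hW : ∀ n, (W n).Countable := by
    intro n
    induction n with
    | zero => exact countable_singleton j
    | succ n ih => exact ih.union (ih.biUnion fun i _ => hT i)
  refine ⟨⋃ n, W n, countable_iUnion hW, mem_iUnion.2 ⟨0, rfl⟩, fun i hi => ?_⟩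
  obtain ⟨n, hn⟩ := mem_iUnion.1 hi
  refine subset_trans ?_ (subset_iUnion W (n + 1))
  intro k hk
  exact Or.inr (mem_biUnion hn hk)

/-- A unital C*-algebra `X` of density `τ > ℵ₀` is projective
if and only if there is a direct C*_ℵ₀-system of subalgebras `(A, F)` of `X`
such that each `F α` is a separable projective unital C*-subalgebra of `X`
(separability is part of being a C*_ℵ₀-system) and each inclusion `F α ↪ X` is
doubly projective. -/
theorem isProjective_iff_exists_direct_omega_system {X : Type u} [CStarAlgebra X]
    {τ : Cardinal.{u}} (hτ : ℵ₀ < τ) (hdens : density X = τ) :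
    IsProjective X ↔
      ∃ (A : Type u) (po : PartialOrder A) (F : A → StarSubalgebra ℂ X),
        @IsDirectCSystem ℵ₀ X _ A po F ∧
        (∀ α : A, IsProjective ↥(F α)) ∧
        (∀ α : A, DoublyProjective (F α).subtype) := by
  constructor
  · intro hX
    obtain ⟨P, _, x, hxn, hxd, hxu⟩ := exists_free X (fun i => ‖i‖) (fun i => norm_nonneg i)
    obtain ⟨q, hq⟩ := hxu X id (fun i => le_rfl)
    have hqs : Function.Surjective q := fun i => ⟨x i, hq i⟩
    obtain ⟨s, hs⟩ := hX P X q hqs (StarAlgHom.id ℂ X)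
    replace hs : ∀ y, q (s y) = y := fun y => DFunLike.congr_fun hs y
    let A : Type u := {S : Set X // S.Countable ∧ ∀ i ∈ S, s i ∈ gen x S}
    let F : A → StarSubalgebra ℂ X := fun S => gen id S.1
    have hsF : ∀ (S : A) (y : X), y ∈ F S → s y ∈ gen x S.1 := by
      intro S y hy
      have : F S ≤ (gen x S.1).comap s :=
        gen_le _ ((gen_closed x _).preimage (sah_cont s)) fun i hi => S.2.2 i hi
      exact this hy
    have hgood : ∀ C : Set A, C.Countable → (⋃₀ (Subtype.val '' C)).Countable ∧
        ∀ i ∈ ⋃₀ (Subtype.val '' C), s i ∈ gen x (⋃₀ (Subtype.val '' C)) := by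
      intro C hC
      refine ⟨(hC.image _).sUnion ?_, ?_⟩
      · rintro _ ⟨S, _, rfl⟩
        exact S.2.1
      · rintro i ⟨_, ⟨S, hS, rfl⟩, hi⟩
        exact gen_mono x (subset_sUnion_of_mem (⟨S, hS, rfl⟩ : S.1 ∈ Subtype.val '' C)) (S.2.2 i hi)
    have hlub : ∀ (C : Set A) (hC : C.Countable),
        IsLUB C (⟨⋃₀ (Subtype.val '' C), hgood C hC⟩ : A) := by
      intro C hC
      refine ⟨fun S hS => ?_, fun T hT => ?_⟩
      · exact subset_sUnion_of_mem (⟨S, hS, rfl⟩ : S.1 ∈ Subtype.val '' C)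
      · refine sUnion_subset ?_
        rintro _ ⟨S, hS, rfl⟩
        exact hT hS
    refine ⟨A, inferInstance, F, ⟨?_, ?_, ?_, ?_, ?_, ?_, ?_⟩, ?_, ?_⟩
    · intro a b
      have h := hlub {a, b} (by simp)
      exact ⟨_, h.1 (by simp), h.1 (by simp)⟩
    · intro C _ _ hC
      exact ⟨_, hlub C (Cardinal.le_aleph0_iff_set_countable.1 hC)⟩
    · exact fun S => gen_closed _ _
    · exact fun S T h => gen_mono _ h
    · intro S
      have h := sep ((id : X → X) '' S.1) (S.2.1.image _)
      obtain ⟨D, h1, h2, h3⟩ := h.exists_countable_dense_subset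
      exact ⟨D, h1, Cardinal.le_aleph0_iff_set_countable.2 h2, h3⟩
    · intro C hch hne hC S hS
      have hS' := hS.unique (hlub C (Cardinal.le_aleph0_iff_set_countable.1 hC))
      rw [hS']
      have := gen_chain (Subtype.val '' C) (hne.image _) (by
        rintro _ ⟨a, ha, rfl⟩ _ ⟨b, hb, rfl⟩ _
        exact hch.total ha hb)
      rw [biUnion_image] at this
      exact this
    · rw [eq_univ_iff_forall]
      intro j
      choose T hT hyT using fun i => exists_countable_gen x hxd (s i)
      obtain ⟨S, hS, hj, hST⟩ := exists_closed_countable T hT j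
      refine subset_closure (mem_iUnion.2 ⟨⟨S, hS, fun i hi => gen_mono x (hST i hi) (hyT i)⟩, ?_⟩)
      exact mem_gen id hj
    · intro S A B _ _ p hp f
      have hcl : IsClosed (F S : Set X) := gen_closed _ _
      classical
      have hch : ∀ i : X, ∃ a : A, ‖a‖ ≤ ‖i‖ ∧ ∀ hi : i ∈ S.1, p a = f ⟨i, mem_gen id hi⟩ := by
        intro i
        by_cases hi : i ∈ S.1
        · obtain ⟨a, h1, h2⟩ := exists_norm_le_lift p hp (f ⟨i, mem_gen id hi⟩)
          exact ⟨a, h2.trans (NonUnitalStarAlgHom.norm_apply_le f _), fun _ => h1⟩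
        · exact ⟨0, by simp, fun h => absurd h hi⟩
      choose a ha1 ha2 using hch
      obtain ⟨ψ, hψ⟩ := hxu A a ha1
      refine ⟨(ψ.comp s).comp (F S).subtype, StarAlgHom.ext fun y => ?_⟩
      have := agree x q hq S.1 f (p.comp ψ) (fun i hi => by
        change p (ψ (x i)) = _
        rw [hψ, ha2 i hi]) (s y.1) (hsF S y.1 y.2) (by rw [hs]; exact y.2)
      change p (ψ (s y.1)) = f y
      refine this.trans ?_
      congr 1
      exact Subtype.ext (hs _)
    · intro S A B _ _ p hp f g hfg
      have hcl : IsClosed (F S : Set X) := gen_closed _ _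
      have hfg' : ∀ y : F S, g y.1 = p (f y) := fun y => DFunLike.congr_fun hfg y
      have hch : ∀ i : X, ∃ a : A, ‖a‖ ≤ ‖i‖ ∧ p a = g i ∧
          ∀ hi : i ∈ S.1, a = f ⟨i, mem_gen id hi⟩ := by
        intro i
        by_cases hi : i ∈ S.1
        · exact ⟨f ⟨i, mem_gen id hi⟩, NonUnitalStarAlgHom.norm_apply_le f _,
            (hfg' _).symm, fun _ => rfl⟩
        · obtain ⟨a, h1, h2⟩ := exists_norm_le_lift p hp (g i)
          exact ⟨a, h2.trans (NonUnitalStarAlgHom.norm_apply_le g _), h1, fun h => absurd h hi⟩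
      choose a ha1 ha2 ha3 using hch
      obtain ⟨ψ, hψ⟩ := hxu A a ha1
      refine ⟨ψ.comp s, StarAlgHom.ext fun y => ?_, StarAlgHom.ext fun y => ?_⟩
      · have := agree x q hq S.1 f ψ (fun i hi => by rw [hψ, ha3 i hi])
          (s y.1) (hsF S y.1 y.2) (by rw [hs]; exact y.2)
        change ψ (s y.1) = f y
        refine this.trans ?_
        congr 1
        exact Subtype.ext (hs _)
      · have hall : ∀ z, p (ψ z) = g (q z) := by
          have hle : (StarAlgebra.adjoin ℂ (range x)).topologicalClosure ≤
              StarAlgHom.equalizer (p.comp ψ) (g.comp q) := by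
            refine StarSubalgebra.topologicalClosure_minimal (StarAlgebra.adjoin_le ?_) ?_
            · rintro _ ⟨i, rfl⟩
              change p (ψ (x i)) = g (q (x i))
              rw [hψ, ha2, hq]
              rfl
            · exact isClosed_eq (sah_cont (p.comp ψ)) (sah_cont (g.comp q))
          intro z
          rw [hxd] at hle
          exact hle (show z ∈ (⊤ : StarSubalgebra ℂ P) from trivial)
        change p (ψ (s y)) = g y
        rw [hall, hs]
  · rintro ⟨I, po, F, hsys, hproj, hdbl⟩ A B _ _ p hp f
    have hne : Nonempty I := by
      by_contra h
      rw [not_nonempty_iff] at h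
      have := hsys.2.2.2.2.2.2
      simp at this
      exact absurd this (by simpa using (empty_ne_univ (α := X)))
    obtain ⟨α⟩ := hne
    obtain ⟨f', hf'⟩ := hproj α A B p hp (f.comp (F α).subtype)
    obtain ⟨h, -, hh⟩ := hdbl α A B p hp f' f hf'.symm
    exact ⟨h, hh⟩
end
end
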